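/- arXiv:2103.10946 — 2 statements merged into one kernel-verified Lean document; each statement's English description precedes it below -/
import Mathlib

section
/- Let H be a separable Hilbert space, p ∈ [1,∞], n, m ∈ ℕ, and let A, B be bounded self-adjoint operators on H. Then ‖BⁿA Bᵐ‖_p ≤ 2 ‖A B^{n+m}‖_p, where ‖·‖_p denotes the Schatten p-norm (with value +∞ allowed, and ‖·‖_∞ the operator norm). If moreover A ≥ 0, then the sharper bound ‖BⁿA Bᵐ‖_p ≤ ‖A B^{n+m}‖_p holds. -/
noncomputable section

open MeasureTheory Complex ENNReal NNReal
open scoped Classical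

variable {E : Type*} [NormedAddCommGroup E] [InnerProductSpace ℂ E]

/-- The trace of a (positive) operator, as a supremum over finite orthonormal families. -/
def traceE (T : E →L[ℂ] E) : ℝ≥0∞ :=
  ⨆ (s : Finset E) (_ : Orthonormal ℂ (fun v : s => (v : E))),
    ∑ v ∈ s, ENNReal.ofReal (Complex.re (inner (𝕜 := ℂ) v (T v)))

/-- `|T|^p = (T^*T)^{p/2}`, via the continuous functional calculus. -/
def absPowE [CompleteSpace E] (T : E →L[ℂ] E) (p : ℝ) : E →L[ℂ] E :=
  cfc (fun x : ℝ => x ^ (p / 2)) (star T * T)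

/-- The Schatten `p`-norm `‖T‖_p = (Tr |T|^p)^{1/p}` (the operator norm for `p = ∞`),
with the value `+∞` allowed. -/
def schattenE [CompleteSpace E] (p : ℝ≥0∞) (T : E →L[ℂ] E) : ℝ≥0∞ :=
  if p = ∞ then (‖T‖₊ : ℝ≥0∞) else traceE (absPowE T p.toReal) ^ (1 / p.toReal)


/-- A finite family satisfying Bessel's inequality. -/
def Bessel {ι : Type*} [Fintype ι] (e : ι → E) : Prop :=
  ∀ x : E, ∑ i, ‖inner ℂ (e i) x‖ ^ 2 ≤ ‖x‖ ^ 2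

/-- Matrix entries of an operator against two families. -/
def Phi (p : ℝ≥0∞) [Fact (1 ≤ p)] {k : ℕ} (e f : Fin k → E) :
    (E →L[ℂ] E) →L[ℂ] PiLp p (fun _ : Fin k => ℂ) :=
  ((PiLp.continuousLinearEquiv p ℂ (fun _ : Fin k => ℂ)).symm :
      (Fin k → ℂ) →L[ℂ] PiLp p (fun _ : Fin k => ℂ)).comp
    (ContinuousLinearMap.pi fun i =>
      (innerSL ℂ (e i)).comp (ContinuousLinearMap.apply ℂ E (f i)))

theorem Phi_apply (p : ℝ≥0∞) [Fact (1 ≤ p)] {k : ℕ} (e f : Fin k → E) (T : E →L[ℂ] E)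
    (i : Fin k) : (Phi p e f T) i = inner ℂ (e i) (T (f i)) := rfl

/-- The variational bound on the Schatten norm. -/
def Bd (p : ℝ≥0∞) [Fact (1 ≤ p)] (T : E →L[ℂ] E) (M : ℝ) : Prop :=
  ∀ (k : ℕ) (e f : Fin k → E), Bessel e → Bessel f → ‖Phi p e f T‖ ≤ M

theorem piLp_norm_congr (p : ℝ≥0∞) [Fact (1 ≤ p)] {k : ℕ} (a b : PiLp p (fun _ : Fin k => ℂ))
    (h : ∀ i, ‖a i‖ = ‖b i‖) : ‖a‖ = ‖b‖ := by
  by_cases hp : p = ∞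
  · subst hp
    rw [PiLp.norm_eq_ciSup, PiLp.norm_eq_ciSup]
    simp only [h]
  · have : 0 < p.toReal :=
      ENNReal.toReal_pos (fun h0 => by have := Fact.out (p := 1 ≤ p); simp [h0] at this) hp
    rw [PiLp.norm_eq_sum this, PiLp.norm_eq_sum this]
    simp only [h]

theorem Bd.nonneg {p : ℝ≥0∞} [Fact (1 ≤ p)] {T : E →L[ℂ] E} {M : ℝ} (h : Bd p T M) : 0 ≤ M :=
  (norm_nonneg _).trans (h 0 (fun _ => 0) (fun _ => 0) (by intro x; simp) (by intro x; simp))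

section Aux

variable [CompleteSpace E]

theorem Bessel.map {ι : Type*} [Fintype ι] {e : ι → E} (he : Bessel e) (W : E →L[ℂ] E)
    (hW : ‖W‖ ≤ 1) : Bessel (fun i => W (e i)) := by
  intro x
  have h1 := he (ContinuousLinearMap.adjoint W x)
  simp only [ContinuousLinearMap.adjoint_inner_right] at h1
  refine h1.trans ?_
  have h2 : ‖ContinuousLinearMap.adjoint W x‖ ≤ ‖x‖ := by
    refine ContinuousLinearMap.le_of_opNorm_le _ (c := 1) ?_ x |>.trans (by simp)
    simpa using hW
  gcongr

theorem Bd.mul {p : ℝ≥0∞} [Fact (1 ≤ p)] {T : E →L[ℂ] E} {M : ℝ} (h : Bd p T M)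
    (V W : E →L[ℂ] E) (hV : ‖V‖ ≤ 1) (hW : ‖W‖ ≤ 1) : Bd p (V * T * W) M := by
  intro k e f he hf
  refine le_trans (le_of_eq ?_) (h k _ _ (he.map (star V) (by rwa [norm_star])) (hf.map W hW))
  congr 1
  ext i
  simp only [Phi_apply, ContinuousLinearMap.star_eq_adjoint,
    ContinuousLinearMap.adjoint_inner_left]
  rfl

theorem Bd.star {p : ℝ≥0∞} [Fact (1 ≤ p)] {T : E →L[ℂ] E} {M : ℝ} (h : Bd p T M) :
    Bd p (star T) M := by
  intro k e f he hf
  refine le_trans (le_of_eq ?_) (h k f e hf he)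
  apply piLp_norm_congr
  intro i
  simp only [Phi_apply, ContinuousLinearMap.star_eq_adjoint,
    ContinuousLinearMap.adjoint_inner_right]
  exact norm_inner_symm _ _

theorem Bd.lim {p : ℝ≥0∞} [Fact (1 ≤ p)] {T : E →L[ℂ] E} {M : ℝ} {α : Type*} {l : Filter α}
    [l.NeBot] {F : α → E →L[ℂ] E} (hF : Filter.Tendsto F l (nhds T))
    (h : ∀ᶠ a in l, Bd p (F a) M) : Bd p T M := by
  intro k e f he hf
  have h1 : Filter.Tendsto (fun a => ‖Phi p e f (F a)‖) l (nhds ‖Phi p e f T‖) :=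
    ((Phi p e f).continuous.norm.tendsto T).comp hF
  refine le_of_tendsto h1 ?_
  filter_upwards [h] with a ha using ha k e f he hf

theorem norm_exp_I (L : E →L[ℂ] E) (hL : IsSelfAdjoint L) (y : ℝ) :
    ‖NormedSpace.exp ((y * Complex.I : ℂ) • L)‖ ≤ 1 := by
  have hy : IsSelfAdjoint (y • L) := IsSelfAdjoint.smul (by simp [IsSelfAdjoint]) hL
  have h := selfAdjoint.expUnitary_coe (⟨y • L, hy⟩ : selfAdjoint (E →L[ℂ] E))
  have h2 : ((y * Complex.I : ℂ) • L) = Complex.I • (y • L) := by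
    rw [mul_comm, mul_smul]; simp
  rw [h2, ← h]
  set u := selfAdjoint.expUnitary (⟨y • L, hy⟩ : selfAdjoint (E →L[ℂ] E))
  have h3 : ‖(u : E →L[ℂ] E)‖ * ‖(u : E →L[ℂ] E)‖ ≤ 1 := by
    rw [← CStarRing.norm_star_mul_self, Unitary.coe_star_mul_self]
    exact ContinuousLinearMap.norm_id_le
  nlinarith [norm_nonneg (u : E →L[ℂ] E)]

theorem exp_split (L : E →L[ℂ] E) (a b : ℂ) :
    NormedSpace.exp ((a + b) • L) = NormedSpace.exp (a • L) * NormedSpace.exp (b • L) := by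
  rw [add_smul]
  let : NormedAlgebra ℚ (E →L[ℂ] E) := NormedAlgebra.restrictScalars ℚ ℂ (E →L[ℂ] E)
  exact NormedSpace.exp_add_of_commute (((Commute.refl L).smul_left a).smul_right b)

theorem three_lines {p : ℝ≥0∞} [Fact (1 ≤ p)] (L X : E →L[ℂ] E) (hL : IsSelfAdjoint L) (M : ℝ)
    (h0 : Bd p (X * NormedSpace.exp L) M) (h1 : Bd p (NormedSpace.exp L * X) M)
    (t : ℝ) (ht0 : 0 ≤ t) (ht1 : t ≤ 1) :
    Bd p (NormedSpace.exp ((t : ℂ) • L) * X * NormedSpace.exp (((1 - t : ℝ) : ℂ) • L)) M := by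
  intro k e f he hf
  have hM := h0.nonneg
  set G : ℂ → (E →L[ℂ] E) := fun z =>
    NormedSpace.exp (z • L) * X * NormedSpace.exp ((1 - z) • L) with hG
  have hdexp : Differentiable ℂ (fun z : ℂ => NormedSpace.exp (z • L)) :=
    fun z => (hasDerivAt_exp_smul_const L z).differentiableAt
  have hdexp' : Differentiable ℂ (fun z : ℂ => NormedSpace.exp ((1 - z) • L)) :=
    hdexp.comp ((differentiable_const (1 : ℂ)).sub differentiable_id)
  have hdG : Differentiable ℂ G := (hdexp.mul_const X).mul hdexp'
  have hd : Differentiable ℂ (fun z => Phi p e f (G z)) := (Phi p e f).differentiable.comp hdG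
  -- rewriting along the vertical direction
  have hsplit : ∀ z : ℂ, G z = NormedSpace.exp ((z.im * Complex.I : ℂ) • L) * G (z.re : ℂ) *
      NormedSpace.exp (((-z.im : ℝ) * Complex.I : ℂ) • L) := by
    intro z
    have e1 : NormedSpace.exp (z • L) = NormedSpace.exp ((z.im * Complex.I : ℂ) • L) *
        NormedSpace.exp ((z.re : ℂ) • L) := by
      rw [← exp_split, add_comm, Complex.re_add_im]
    have e2 : NormedSpace.exp ((1 - z) • L) = NormedSpace.exp ((1 - (z.re : ℂ)) • L) *
        NormedSpace.exp (((-z.im : ℝ) * Complex.I : ℂ) • L) := by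
      rw [← exp_split]
      congr 2
      conv_lhs => rw [← Complex.re_add_im z]
      push_cast; ring
    simp only [hG, e1, e2, mul_assoc]
  have hBdG : ∀ z : ℂ, Bd p (G (z.re : ℂ)) M → ‖Phi p e f (G z)‖ ≤ M := by
    intro z hz
    rw [hsplit z]
    exact hz.mul _ _ (norm_exp_I L hL _) (norm_exp_I L hL _) k e f he hf
  obtain ⟨C, hC⟩ : ∃ C, ∀ x ∈ Set.Icc (0 : ℝ) 1, ‖G (x : ℂ)‖ ≤ C :=
    isCompact_Icc.exists_bound_of_continuousOn
      (hdG.continuous.comp Complex.continuous_ofReal).continuousOn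
  have hB : BddAbove ((norm ∘ fun z => Phi p e f (G z)) ''
      Complex.HadamardThreeLines.verticalClosedStrip 0 1) := by
    refine ⟨‖Phi p e f‖ * C, ?_⟩
    rintro _ ⟨z, hz, rfl⟩
    refine (ContinuousLinearMap.le_opNorm _ _).trans ?_
    gcongr
    rw [hsplit z]
    refine (norm_mul_le _ _).trans ?_
    have a1 := norm_exp_I L hL z.im
    have a2 := norm_exp_I L hL (-z.im)
    have a3 := hC z.re hz
    calc _ ≤ (1 * C) * 1 := by
          refine mul_le_mul ((norm_mul_le _ _).trans ?_) a2 (norm_nonneg _) ?_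
          · exact mul_le_mul a1 a3 (norm_nonneg _) zero_le_one
          · simpa using (norm_nonneg _).trans a3
      _ = C := by ring
  have key := Complex.HadamardThreeLines.norm_le_interp_of_mem_verticalClosedStrip'
    (f := fun z => Phi p e f (G z)) (z := (t : ℂ)) (a := M) (b := M) (l := 0) (u := 1)
    zero_lt_one (by simp [Complex.HadamardThreeLines.verticalClosedStrip, ht0, ht1])
    hd.diffContOnCl hB
    (by
      intro z hz
      apply hBdG
      have : z.re = 0 := hz
      rw [this]
      simpa [hG] using h0)
    (by
      intro z hz
      apply hBdG
      have : z.re = 1 := hz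
      rw [this]
      simpa [hG] using h1)
  have hfin : M ^ (1 - ((t : ℂ).re - 0) / (1 - 0)) * M ^ (((t : ℂ).re - 0) / (1 - 0)) = M := by
    rw [← Real.rpow_add_of_nonneg hM]
    · simp
    · simp [ht1]
    · simp [ht0]
  rw [hfin] at key
  simpa [hG] using key

/-- The regularised modulus of `B`, as a scalar function. -/
def rr (ε x : ℝ) : ℝ := Real.sqrt (x ^ 2 + ε ^ 2)

theorem rr_pos {ε : ℝ} (hε : 0 < ε) (x : ℝ) : 0 < rr ε x := by
  unfold rr; positivity

theorem rr_cont (ε : ℝ) : Continuous (rr ε) := by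
  unfold rr; fun_prop

theorem abs_le_rr (ε x : ℝ) : |x| ≤ rr ε x := by
  unfold rr
  rw [← Real.sqrt_sq_eq_abs]
  exact Real.sqrt_le_sqrt (by nlinarith [sq_nonneg ε])

theorem rr_sq (ε x : ℝ) : rr ε x ^ 2 = x ^ 2 + ε ^ 2 := by
  unfold rr; rw [Real.sq_sqrt (by positivity)]

theorem approx_scalar {ε : ℝ} (hε : 0 < ε) (n m : ℕ) (hn : 1 ≤ n) (R x : ℝ) (hx : |x| ≤ R) :
    |x ^ n * (x ^ 2 / rr ε x ^ 2) ^ m - x ^ n| ≤ R ^ (n - 1) * (m * ε) := by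
  obtain ⟨n, rfl⟩ : ∃ n', n = n' + 1 := ⟨n - 1, by omega⟩
  rw [rr_sq]
  have hpos : 0 < x ^ 2 + ε ^ 2 := by positivity
  set y := x ^ 2 / (x ^ 2 + ε ^ 2) with hy
  have hy1 : 1 - y = ε ^ 2 / (x ^ 2 + ε ^ 2) := by rw [hy]; field_simp; ring
  have hy0 : 0 ≤ y := by positivity
  have hyl : y ≤ 1 := by have : 0 ≤ 1 - y := by rw [hy1]; positivity
                         linarith
  have hb : 1 - y ^ m ≤ m * (1 - y) := by
    have := one_add_mul_le_pow (a := y - 1) (by linarith) m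
    simp only [add_sub_cancel] at this
    linarith
  have hym : y ^ m ≤ 1 := pow_le_one₀ hy0 hyl
  have hxy : |x| * (1 - y) ≤ ε := by
    rw [hy1, ← mul_div_assoc, div_le_iff₀ hpos]
    nlinarith [sq_nonneg (|x| - ε), sq_abs x, abs_nonneg x]
  have e : x ^ (n + 1) * y ^ m - x ^ (n + 1) = - (x ^ n * (x * (1 - y ^ m))) := by ring
  rw [e, abs_neg, abs_mul, abs_mul, abs_pow, abs_of_nonneg (sub_nonneg.2 hym), Nat.add_sub_cancel]
  have hR : 0 ≤ R := (abs_nonneg x).trans hx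
  refine mul_le_mul (pow_le_pow_left₀ (abs_nonneg x) hx n) ?_
    (mul_nonneg (abs_nonneg _) (sub_nonneg.2 hym)) (by positivity)
  calc |x| * (1 - y ^ m) ≤ |x| * (m * (1 - y)) := by gcongr
    _ = m * (|x| * (1 - y)) := by ring
    _ ≤ m * ε := by gcongr

theorem approx_op (B : E →L[ℂ] E) (hB : IsSelfAdjoint B) (n m : ℕ) (hn : 1 ≤ n) {ε : ℝ}
    (hε : 0 < ε) :
    ‖cfc (fun x : ℝ => x ^ n * (x ^ 2 / rr ε x ^ 2) ^ m) B - B ^ n‖ ≤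
      ‖B‖ ^ (n - 1) * (m * ε) := by
  have hc := rr_cont ε
  have hne : ∀ x, rr ε x ^ 2 ≠ 0 := fun x => (pow_pos (rr_pos hε x) 2).ne'
  rw [← cfc_pow_id (R := ℝ) B n, ← cfc_sub _ _ B
    (Continuous.continuousOn (by fun_prop (disch := assumption))) (by fun_prop)]
  refine norm_cfc_le (by positivity) ?_
  intro x hx
  rw [Real.norm_eq_abs]
  exact approx_scalar hε n m hn _ x ((spectrum.norm_le_norm_mul_of_mem hx).trans
    (mul_le_of_le_one_right (norm_nonneg _) ContinuousLinearMap.norm_id_le))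

theorem approx_tendsto (B : E →L[ℂ] E) (hB : IsSelfAdjoint B) (n m : ℕ) (hn : 1 ≤ n) :
    Filter.Tendsto (fun ε : ℝ => cfc (fun x : ℝ => x ^ n * (x ^ 2 / rr ε x ^ 2) ^ m) B)
      (nhdsWithin 0 (Set.Ioi 0)) (nhds (B ^ n)) := by
  rw [tendsto_iff_norm_sub_tendsto_zero]
  have h : Filter.Tendsto (fun ε : ℝ => ‖B‖ ^ (n - 1) * (m * ε)) (nhdsWithin 0 (Set.Ioi 0))
      (nhds 0) := by
    have : Continuous (fun ε : ℝ => ‖B‖ ^ (n - 1) * (m * ε)) := by fun_prop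
    have h2 := this.tendsto 0
    simp only [mul_zero] at h2
    exact h2.mono_left nhdsWithin_le_nhds
  refine squeeze_zero' (Filter.Eventually.of_forall fun _ => norm_nonneg _) ?_ h
  filter_upwards [self_mem_nhdsWithin] with ε hε using approx_op B hB n m hn hε

theorem Bd_step {p : ℝ≥0∞} [Fact (1 ≤ p)] (A B : E →L[ℂ] E) (hA : IsSelfAdjoint A)
    (hB : IsSelfAdjoint B) (n m : ℕ) (hn : 1 ≤ n) (M : ℝ)
    (h : Bd p (A * B ^ (n + m)) M) {ε : ℝ} (hε : 0 < ε) :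
    Bd p (cfc (fun x : ℝ => x ^ n * (x ^ 2 / rr ε x ^ 2) ^ m) B * A *
      cfc (fun x : ℝ => x ^ m * (x ^ 2 / rr ε x ^ 2) ^ n) B) M := by
  have hc := rr_cont ε
  have hne : ∀ x, rr ε x ≠ 0 := fun x => (rr_pos hε x).ne'
  have hne2 : ∀ (k : ℕ) x, rr ε x ^ k ≠ 0 := fun k x => pow_ne_zero _ (hne x)
  have hNpos : (0 : ℝ) < (n + m : ℕ) := by exact_mod_cast (by omega)
  have hlc : Continuous fun x => Real.log (rr ε x) := hc.log hne
  have hlk : ∀ k : ℕ, Continuous fun x => (k : ℝ) * Real.log (rr ε x) :=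
    fun k => continuous_const.mul hlc
  set L : E →L[ℂ] E := cfc (fun x : ℝ => (n + m : ℕ) * Real.log (rr ε x)) B with hLdef
  have hL : IsSelfAdjoint L := cfc_predicate _ _
  have hexp : ∀ (t : ℝ) (k : ℕ), t * (n + m : ℕ) = k →
      NormedSpace.exp ((t : ℂ) • L) = cfc (fun x : ℝ => rr ε x ^ k) B := by
    intro t k htk
    have e1 : (t : ℂ) • L = cfc (fun x : ℝ => k * Real.log (rr ε x)) B := by
      have : (t : ℂ) • L = t • L := by simp
      rw [this, hLdef, ← cfc_const_mul t _ B (hlk _).continuousOn]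
      congr 1
      funext x
      rw [← htk]; ring
    rw [e1, ← CFC.real_exp_eq_normedSpace_exp (cfc_predicate _ _),
      ← cfc_comp Real.exp _ B hB (by fun_prop)
        (hlk _).continuousOn]
    congr 1
    funext x
    simp only [Function.comp]
    rw [mul_comm, Real.exp_mul, Real.exp_log (rr_pos hε x), Real.rpow_natCast]
  have hexp1 : NormedSpace.exp L = cfc (fun x : ℝ => rr ε x ^ (n + m)) B := by
    have := hexp 1 (n + m) (by simp)
    simpa using this
  set D : E →L[ℂ] E := cfc (fun x : ℝ => (x / rr ε x) ^ (n + m)) B with hD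
  have hcontr : ∀ k : ℕ, ‖cfc (fun x : ℝ => (x / rr ε x) ^ k) B‖ ≤ 1 := by
    intro k
    refine norm_cfc_le zero_le_one ?_
    intro x _
    rw [norm_pow, norm_div, Real.norm_eq_abs, Real.norm_eq_abs, abs_of_pos (rr_pos hε x)]
    exact pow_le_one₀ (by have := rr_pos hε x; positivity)
      (div_le_one_of_le₀ (abs_le_rr ε x) (rr_pos hε x).le)
  have hDs : IsSelfAdjoint D := cfc_predicate _ _
  have hexps : IsSelfAdjoint (NormedSpace.exp L) := hexp1 ▸ cfc_predicate _ _
  have hcq : ∀ k : ℕ, Continuous (fun x : ℝ => (x / rr ε x) ^ k) := by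
    intro k; fun_prop (disch := assumption)
  have hDexp : D * NormedSpace.exp L = B ^ (n + m) := by
    rw [hexp1, hD, ← cfc_mul _ _ B (hcq _).continuousOn (by fun_prop),
      ← cfc_pow_id (R := ℝ) B (n + m)]
    congr 1
    funext x
    rw [div_pow, div_mul_cancel₀ _ (hne2 _ x)]
  have h0 : Bd p (D * A * D * NormedSpace.exp L) M := by
    have := h.mul D 1 (hcontr _) ContinuousLinearMap.norm_id_le
    rw [← hDexp] at this
    simpa [mul_assoc] using this
  have h1 : Bd p (NormedSpace.exp L * (D * A * D)) M := by
    have := h0.star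
    simpa [star_mul, hDs.star_eq, hexps.star_eq, hA.star_eq, mul_assoc] using this
  have h2 := three_lines L (D * A * D) hL M h0 h1 (n / (n + m : ℕ)) (by positivity)
    (by rw [div_le_one hNpos]; push_cast; linarith [(Nat.cast_nonneg m : (0:ℝ) ≤ m)])
  rw [hexp _ n (by field_simp), hexp _ m (by push_cast at hNpos ⊢; field_simp; ring)] at h2
  have h3 := h2.mul _ _ (hcontr m) (hcontr n)
  have hq1 : Continuous fun x => rr ε x ^ n * (x / rr ε x) ^ (n + m) :=
    (hc.pow n).mul (hcq _)
  have hq2 : Continuous fun x => (x / rr ε x) ^ (n + m) * rr ε x ^ m :=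
    (hcq _).mul (hc.pow m)
  have e1 : cfc (fun x : ℝ => x ^ n * (x ^ 2 / rr ε x ^ 2) ^ m) B =
      cfc (fun x : ℝ => (x / rr ε x) ^ m) B * (cfc (fun x : ℝ => rr ε x ^ n) B * D) := by
    rw [hD, ← cfc_mul _ _ B (by fun_prop) (hcq _).continuousOn,
      ← cfc_mul _ _ B (hcq _).continuousOn
        hq1.continuousOn]
    congr 1
    funext x
    have hx : x ^ n = (x / rr ε x) ^ n * rr ε x ^ n := by
      rw [div_pow, div_mul_cancel₀ _ (hne2 _ x)]
    rw [← div_pow, hx]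
    ring
  have e2 : cfc (fun x : ℝ => x ^ m * (x ^ 2 / rr ε x ^ 2) ^ n) B =
      D * cfc (fun x : ℝ => rr ε x ^ m) B * cfc (fun x : ℝ => (x / rr ε x) ^ n) B := by
    rw [hD, ← cfc_mul _ _ B (hcq _).continuousOn (by fun_prop),
      ← cfc_mul _ _ B hq2.continuousOn (hcq _).continuousOn]
    congr 1
    funext x
    have hx : x ^ m = (x / rr ε x) ^ m * rr ε x ^ m := by
      rw [div_pow, div_mul_cancel₀ _ (hne2 _ x)]
    rw [← div_pow, hx]
    ring
  rw [e1, e2]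
  simpa only [mul_assoc] using h3

theorem Bd_unmix {p : ℝ≥0∞} [Fact (1 ≤ p)] (A B : E →L[ℂ] E) (hA : IsSelfAdjoint A)
    (hB : IsSelfAdjoint B) (n m : ℕ) (M : ℝ)
    (h : Bd p (A * B ^ (n + m)) M) : Bd p (B ^ n * A * B ^ m) M := by
  rcases Nat.eq_zero_or_pos n with rfl | hn
  · simpa using h
  rcases Nat.eq_zero_or_pos m with rfl | hm
  · have := h.star
    simpa [star_mul, hA.star_eq, star_pow, hB.star_eq] using this
  refine Bd.lim (l := nhdsWithin (0 : ℝ) (Set.Ioi 0))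
    (((approx_tendsto B hB n m hn).mul_const A).mul (approx_tendsto B hB m n hm)) ?_
  filter_upwards [self_mem_nhdsWithin] with ε hε
  exact Bd_step A B hA hB n m hn M h hε

theorem weight_ineq {ι κ : Type*} (I : Finset ι) (J : Finset κ) {p : ℝ} (hp : 1 ≤ p)
    (a : ι → κ → ℝ) (s : κ → ℝ) (ha : ∀ i j, 0 ≤ a i j) (hs : ∀ j, 0 ≤ s j)
    (hrow : ∀ i ∈ I, ∑ j ∈ J, a i j ≤ 1) (hcol : ∀ j ∈ J, ∑ i ∈ I, a i j ≤ 1) :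
    ∑ i ∈ I, (∑ j ∈ J, a i j * s j) ^ p ≤ ∑ j ∈ J, s j ^ p := by
  have hp0 : 0 < p := by linarith
  have h1 : ∀ i ∈ I, (∑ j ∈ J, a i j * s j) ^ p ≤ ∑ j ∈ J, a i j * s j ^ p := by
    intro i hi
    have h := Real.inner_le_weight_mul_Lp_of_nonneg J hp (a i) s (ha i) hs
    have h0 : 0 ≤ ∑ j ∈ J, a i j * s j ^ p :=
      Finset.sum_nonneg fun j _ => mul_nonneg (ha i j) (Real.rpow_nonneg (hs j) p)
    have h2 : (∑ j ∈ J, a i j) ^ (1 - p⁻¹) ≤ 1 :=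
      Real.rpow_le_one (Finset.sum_nonneg fun j _ => ha i j) (hrow i hi)
        (sub_nonneg.2 (inv_le_one_of_one_le₀ hp))
    have h3 : ∑ j ∈ J, a i j * s j ≤ (∑ j ∈ J, a i j * s j ^ p) ^ p⁻¹ :=
      h.trans (mul_le_of_le_one_left (Real.rpow_nonneg h0 _) h2)
    calc _ ≤ ((∑ j ∈ J, a i j * s j ^ p) ^ p⁻¹) ^ p :=
          Real.rpow_le_rpow (Finset.sum_nonneg fun j _ => mul_nonneg (ha i j) (hs j)) h3 hp0.le
      _ = _ := Real.rpow_inv_rpow h0 hp0.ne'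
  calc _ ≤ ∑ i ∈ I, ∑ j ∈ J, a i j * s j ^ p := Finset.sum_le_sum h1
    _ = ∑ j ∈ J, (∑ i ∈ I, a i j) * s j ^ p := by
        rw [Finset.sum_comm]; simp only [Finset.sum_mul]
    _ ≤ _ := Finset.sum_le_sum fun j hj =>
        mul_le_of_le_one_left (Real.rpow_nonneg (hs j) p) (hcol j hj)

theorem cfc_eigen (a : E →L[ℂ] E) (ha : IsSelfAdjoint a) (v : E) (x : ℝ)
    (hv : a v = (x : ℂ) • v) (f : ℝ → ℝ) (hf : Continuous f) :
    cfc f a v = (f x : ℂ) • v := by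
  by_cases hv0 : v = 0
  · simp [hv0]
  have hx : x ∈ spectrum ℝ a := by
    intro hu
    obtain ⟨u, hu⟩ := hu
    have h1 : (u : E →L[ℂ] E) v = 0 := by
      rw [hu]
      simp [hv, Algebra.algebraMap_eq_smul_one]
    have h2 : ((u⁻¹ : (E →L[ℂ] E)ˣ) : E →L[ℂ] E) ((u : E →L[ℂ] E) v) = v := by
      rw [← mul_apply_eq_comp, Units.inv_mul]; rfl
    rw [h1, map_zero] at h2
    exact hv0 h2.symm
  have key : ∀ g : C(spectrum ℝ a, ℝ), cfcHom ha g v = (g ⟨x, hx⟩ : ℂ) • v := by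
    intro g
    have hid : cfcHom ha (ContinuousMap.restrict (spectrum ℝ a) (ContinuousMap.id ℝ)) = a :=
      cfcHom_id ha
    induction g using ContinuousMap.induction_on_of_compact with
    | const r =>
      have : (ContinuousMap.const (spectrum ℝ a) r) = algebraMap ℝ C(spectrum ℝ a, ℝ) r := rfl
      rw [this, AlgHomClass.commutes]
      simp [Algebra.algebraMap_eq_smul_one]
    | id => rw [hid]; simpa using hv
    | star_id => rw [map_star, hid, ha.star_eq]; simpa using hv
    | add f g hf hg => simp [map_add, hf, hg, add_smul]
    | mul f g hf hg =>
      rw [map_mul, mul_apply_eq_comp, hg, map_smul, hf, smul_smul]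
      simp [mul_comm]
    | frequently f hfreq =>
      have hcl : IsClosed {g : C(spectrum ℝ a, ℝ) | cfcHom ha g v = (g ⟨x, hx⟩ : ℂ) • v} := by
        refine isClosed_eq ?_ ?_
        · have := (cfcHom_continuous (R := ℝ) ha)
          exact (ContinuousLinearMap.apply ℂ E v).continuous.comp this
        · have : Continuous fun g : C(spectrum ℝ a, ℝ) => g ⟨x, hx⟩ :=
            continuous_eval_const _
          exact (Complex.continuous_ofReal.comp this).smul continuous_const
      exact hcl.mem_of_frequently_of_tendsto hfreq Filter.tendsto_id
  rw [cfc_apply f a ha hf.continuousOn, key]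
  rfl

theorem eigenbasis.{u} {E : Type u} [NormedAddCommGroup E] [InnerProductSpace ℂ E]
    [CompleteSpace E] (S : E →L[ℂ] E) (hS : IsSelfAdjoint S) (hc : IsCompactOperator S) :
    ∃ (ι : Type u) (b : HilbertBasis ι ℂ E) (μ : ι → ℂ), ∀ i, S (b i) = μ i • b i := by
  have hsym : (S : E →ₗ[ℂ] E).IsSymmetric := hS.isSymmetric
  have hcl : ∀ μ : ℂ, CompleteSpace (Module.End.eigenspace (S : E →ₗ[ℂ] E) μ) := by
    intro μ
    have : IsClosed ((Module.End.eigenspace (S : E →ₗ[ℂ] E) μ : Set E)) := by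
      have h : (Module.End.eigenspace (S : E →ₗ[ℂ] E) μ : Set E) = {x | S x = μ • x} := by
        ext x; simp
      rw [h]
      exact isClosed_eq S.continuous (continuous_const_smul μ)
    exact this.completeSpace_coe
  choose w b hb using fun μ : ℂ => exists_hilbertBasis ℂ (Module.End.eigenspace (S : E →ₗ[ℂ] E) μ)
  have hon := hsym.orthogonalFamily_eigenspaces.orthonormal_sigma_orthonormal
    (v_family := fun μ => b μ) (fun μ => (b μ).orthonormal)
  refine ⟨(Σ μ : ℂ, w μ), HilbertBasis.mkOfOrthogonalEqBot hon ?_, fun i => i.1, ?_⟩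
  · rw [Submodule.eq_bot_iff]
    intro x hx
    have h0 := ContinuousLinearMap.orthogonalComplement_iSup_eigenspaces_eq_bot hc hsym
    rw [Submodule.eq_bot_iff] at h0
    apply h0
    rw [← Submodule.iInf_orthogonal, Submodule.mem_iInf]
    intro μ
    rw [Submodule.mem_orthogonal]
    intro y hy
    have hs := (b μ).hasSum_repr ⟨y, hy⟩
    have hs2 := hs.mapL ((innerSL ℂ x).comp (Submodule.subtypeL _))
    have hz : ∀ i, ((innerSL ℂ x).comp
        (Submodule.subtypeL (Module.End.eigenspace (S : E →ₗ[ℂ] E) μ)))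
        ((b μ).repr ⟨y, hy⟩ i • b μ i) = 0 := by
      intro i
      rw [map_smul]
      have : inner ℂ x ((b μ i : Module.End.eigenspace (S : E →ₗ[ℂ] E) μ) : E) = 0 := by
        rw [inner_eq_zero_symm]
        exact (Submodule.mem_orthogonal _ _).1 hx _ (Submodule.subset_span ⟨⟨μ, i⟩, rfl⟩)
      simp [this]
    simp only [hz] at hs2
    have := hs2.unique hasSum_zero
    rw [inner_eq_zero_symm]
    simpa using this
  · intro i
    rw [HilbertBasis.coe_mkOfOrthogonalEqBot]
    exact Module.End.mem_eigenspace_iff.1 (b i.1 i.2).2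

theorem inner_star_mul (T : E →L[ℂ] E) (x y : E) :
    inner ℂ x ((star T * T) y) = inner ℂ (T x) (T y) := by
  rw [mul_apply_eq_comp, ContinuousLinearMap.star_eq_adjoint,
    ContinuousLinearMap.adjoint_inner_right]

theorem svd.{u} {E : Type u} [NormedAddCommGroup E] [InnerProductSpace ℂ E]
    [CompleteSpace E] (T : E →L[ℂ] E) (hc : IsCompactOperator T) :
    ∃ (ι : Type u) (b : HilbertBasis ι ℂ E),
      (∀ i, (star T * T) (b i) = ((‖T (b i)‖ ^ 2 : ℝ) : ℂ) • b i) ∧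
      (∀ i j, i ≠ j → inner ℂ (T (b i)) (T (b j)) = 0) := by
  have hcc : IsCompactOperator (star T * T : E →L[ℂ] E) := hc.clm_comp (star T)
  obtain ⟨ι, b, μ, hb⟩ := eigenbasis (star T * T) (IsSelfAdjoint.star_mul_self T) hcc
  refine ⟨ι, b, ?_, ?_⟩
  · intro i
    have h1 := inner_star_mul T (b i) (b i)
    rw [hb i, inner_smul_right, inner_self_eq_norm_sq_to_K, inner_self_eq_norm_sq_to_K,
      b.orthonormal.1 i] at h1
    rw [hb i]
    congr 1
    simpa using h1
  · intro i j hij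
    rw [← inner_star_mul, hb j, inner_smul_right, b.orthonormal.2 hij, mul_zero]

theorem absPow_eigen (T : E →L[ℂ] E) (p : ℝ) (hp : 0 ≤ p) (v : E)
    (hv : (star T * T) v = ((‖T v‖ ^ 2 : ℝ) : ℂ) • v) :
    absPowE T p v = ((‖T v‖ ^ p : ℝ) : ℂ) • v := by
  unfold absPowE
  rw [cfc_eigen _ (IsSelfAdjoint.star_mul_self T) v _ hv _
    (Real.continuous_rpow_const (by positivity))]
  congr 2
  rw [← Real.rpow_natCast, ← Real.rpow_mul (norm_nonneg _)]
  congr 1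
  push_cast; ring

theorem absPow_selfAdjoint (T : E →L[ℂ] E) (p : ℝ) : IsSelfAdjoint (absPowE T p) :=
  cfc_predicate _ _

theorem bessel_orth {ι : Type*} (J : Finset ι) (u : ι → E)
    (ho : ∀ i j, i ≠ j → inner ℂ (u i) (u j) = 0) (hn : ∀ i, ‖u i‖ ≤ 1) (x : E) :
    ∑ j ∈ J, ‖inner ℂ (u j) x‖ ^ 2 ≤ ‖x‖ ^ 2 := by
  set S := ∑ j ∈ J, ‖inner ℂ (u j) x‖ ^ 2 with hS
  set y := ∑ j ∈ J, inner ℂ (u j) x • u j with hy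
  have h1 : inner ℂ y x = (S : ℂ) := by
    rw [hy, sum_inner, hS]
    push_cast
    refine Finset.sum_congr rfl fun j _ => ?_
    rw [inner_smul_left, RCLike.conj_mul]
    rfl
  have h2 : ‖y‖ ^ 2 ≤ S := by
    have : inner ℂ y y = ((∑ j ∈ J, ‖inner ℂ (u j) x‖ ^ 2 * ‖u j‖ ^ 2 : ℝ) : ℂ) := by
      conv_lhs => rw [hy, sum_inner]
      push_cast
      refine Finset.sum_congr rfl fun j hj => ?_
      rw [inner_sum, Finset.sum_eq_single j]
      · rw [inner_smul_left, inner_smul_right, inner_self_eq_norm_sq_to_K, ← mul_assoc,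
          RCLike.conj_mul]
        rfl
      · intro k _ hk
        rw [inner_smul_left, inner_smul_right, ho j k hk.symm]; simp
      · exact fun h => absurd hj h
    rw [inner_self_eq_norm_sq_to_K] at this
    have h3 : ‖y‖ ^ 2 = ∑ j ∈ J, ‖inner ℂ (u j) x‖ ^ 2 * ‖u j‖ ^ 2 := by
      apply Complex.ofReal_injective
      rw [← this]
      push_cast
      rfl
    rw [h3, hS]
    refine Finset.sum_le_sum fun j _ => mul_le_of_le_one_right (by positivity) ?_
    exact pow_le_one₀ (norm_nonneg _) (hn j)
  have h3 := @norm_sub_sq ℂ E _ _ _ y x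
  rw [h1] at h3
  have h4 : RCLike.re (S : ℂ) = S := Complex.ofReal_re S
  rw [h4] at h3
  nlinarith [sq_nonneg ‖y - x‖]

theorem trace_ge {ι : Type*} (Q : E →L[ℂ] E) (v : ι → E) (hv : Orthonormal ℂ v)
    (J : Finset ι) :
    ∑ j ∈ J, ENNReal.ofReal (Complex.re (inner ℂ (v j) (Q (v j)))) ≤ traceE Q := by
  have hinj : Function.Injective v := hv.linearIndependent.injective
  have hon : Orthonormal ℂ (fun w : (J.image v : Finset E) => (w : E)) := by
    have hex : ∀ w : (J.image v : Finset E), ∃ j, v j = w := by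
      intro w
      obtain ⟨j, _, hj⟩ := Finset.mem_image.1 w.2
      exact ⟨j, hj⟩
    choose g hg using hex
    have hgi : Function.Injective g := by
      intro a b hab
      apply Subtype.ext
      rw [← hg a, ← hg b, hab]
    have := hv.comp g hgi
    convert this using 1
    funext w
    exact (hg w).symm
  have h1 : ∑ j ∈ J, ENNReal.ofReal (Complex.re (inner ℂ (v j) (Q (v j)))) =
      ∑ w ∈ J.image v, ENNReal.ofReal (Complex.re (inner ℂ w (Q w))) := by
    rw [Finset.sum_image (fun a _ b _ h => hinj h)]
  rw [h1]
  unfold traceE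
  exact le_iSup₂_of_le (J.image v) hon le_rfl

theorem trace_ge_real {ι : Type*} (Q : E →L[ℂ] E) (M : ℝ) (hM : 0 ≤ M)
    (hQ : ∀ x, 0 ≤ Complex.re (inner ℂ x (Q x)))
    (h : traceE Q ≤ ENNReal.ofReal M) (v : ι → E) (hv : Orthonormal ℂ v) (J : Finset ι) :
    ∑ j ∈ J, Complex.re (inner ℂ (v j) (Q (v j))) ≤ M := by
  have h1 := (trace_ge Q v hv J).trans h
  rw [← ENNReal.ofReal_sum_of_nonneg fun j _ => hQ _] at h1
  exact (ENNReal.ofReal_le_ofReal_iff hM).1 h1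

theorem compact_of_bound (T : E →L[ℂ] E)
    (H : ∀ δ : ℝ, 0 < δ → ∃ K : ℕ, ∀ (k : ℕ) (v : Fin k → E), Orthonormal ℂ v →
      (∀ i, δ < ‖T (v i)‖) → (∀ i j, i ≠ j → inner ℂ (T (v i)) (T (v j)) = 0) → k ≤ K) :
    IsCompactOperator T := by
  -- approximate on the complement of a finite-dimensional subspace
  have claim : ∀ δ : ℝ, 0 < δ → ∃ V : Submodule ℂ E, FiniteDimensional ℂ V ∧
      ∀ w ∈ Vᗮ, ‖T w‖ ≤ δ * ‖w‖ := by
    intro δ hδ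
    by_contra! hcon
    obtain ⟨K, hK⟩ := H δ hδ
    have ex : ∀ k : ℕ, ∃ v : Fin k → E, Orthonormal ℂ v ∧ (∀ i, δ < ‖T (v i)‖) ∧
        (∀ i j, i ≠ j → inner ℂ (T (v i)) (T (v j)) = 0) := by
      intro k
      induction k with
      | zero =>
        exact ⟨fun i => i.elim0, ⟨fun i => i.elim0, fun i => i.elim0⟩, fun i => i.elim0,
          fun i => i.elim0⟩
      | succ k ih =>
        obtain ⟨v, hv, hvδ, hvo⟩ := ih
        let V : Submodule ℂ E := Submodule.span ℂ
          (Set.range v ∪ Set.range fun i => (star T * T) (v i))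
        have hfd : FiniteDimensional ℂ V :=
          FiniteDimensional.span_of_finite ℂ ((Set.finite_range _).union (Set.finite_range _))
        obtain ⟨w, hw, hwδ⟩ := hcon V hfd
        have hw0 : w ≠ 0 := by
          rintro rfl
          simp at hwδ
        have hwn : 0 < ‖w‖ := norm_pos_iff.2 hw0
        have hwv : ∀ i, inner ℂ (v i) w = 0 := fun i =>
          (Submodule.mem_orthogonal _ _).1 hw _ (Submodule.subset_span (Or.inl ⟨i, rfl⟩))
        have hwT : ∀ i, inner ℂ (T w) (T (v i)) = 0 := by
          intro i
          rw [← inner_star_mul, inner_eq_zero_symm]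
          exact (Submodule.mem_orthogonal _ _).1 hw _ (Submodule.subset_span (Or.inr ⟨i, rfl⟩))
        set w' : E := ((‖w‖⁻¹ : ℝ) : ℂ) • w with hw'
        have n1 : ‖w'‖ = 1 := by
          rw [hw', norm_smul]
          simp [hwn.ne']
        have o1 : ∀ i, inner ℂ (v i) w' = 0 := fun i => by
          rw [hw', inner_smul_right, hwv i, mul_zero]
        have o2 : ∀ i, inner ℂ (T w') (T (v i)) = 0 := fun i => by
          rw [hw', map_smul, inner_smul_left, hwT i, mul_zero]
        have d1 : δ < ‖T w'‖ := by
          rw [hw', map_smul, norm_smul]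
          simp only [Complex.norm_real, norm_inv, norm_norm]
          rw [inv_mul_eq_div, lt_div_iff₀ hwn]
          exact hwδ
        refine ⟨Fin.cons w' v, ⟨?_, ?_⟩, ?_, ?_⟩
        · intro i
          refine Fin.cases ?_ (fun i => ?_) i
          · simpa using n1
          · simpa using hv.1 i
        · intro i j
          refine Fin.cases ?_ (fun i => ?_) i <;> refine Fin.cases ?_ (fun j => ?_) j
          · intro h; exact absurd rfl h
          · intro _; simpa [inner_eq_zero_symm] using inner_eq_zero_symm.1 (o1 j)
          · intro _; simpa using o1 i
          · intro h; simpa using hv.2 (fun h' => h (by rw [h']))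
        · intro i
          refine Fin.cases ?_ (fun i => ?_) i
          · simpa using d1
          · simpa using hvδ i
        · intro i j
          refine Fin.cases ?_ (fun i => ?_) i <;> refine Fin.cases ?_ (fun j => ?_) j
          · intro h; exact absurd rfl h
          · intro _; simpa using o2 j
          · intro _; simpa using inner_eq_zero_symm.1 (o2 i)
          · intro h; simpa using hvo i j (fun h' => h (by rw [h']))
    obtain ⟨v, h1, h2, h3⟩ := ex (K + 1)
    have := hK (K + 1) v h1 h2 h3
    omega
  choose V hVfd hV using fun n : ℕ => claim (1 / ((n : ℝ) + 1)) (by positivity)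
  have hlim : Filter.Tendsto (fun n => T * (V n).starProjection) Filter.atTop (nhds T) := by
    rw [tendsto_iff_norm_sub_tendsto_zero]
    refine squeeze_zero (fun _ => norm_nonneg _) ?_ tendsto_one_div_add_atTop_nhds_zero_nat
    intro n
    refine ContinuousLinearMap.opNorm_le_bound _ (by positivity) ?_
    intro x
    have h1 := hV n (x - (V n).starProjection x)
      (Submodule.sub_starProjection_mem_orthogonal x)
    have h2 : ‖x - (V n).starProjection x‖ ≤ ‖x‖ := by
      have e : x - (V n).starProjection x = (V n)ᗮ.starProjection x := by
        rw [Submodule.starProjection_orthogonal']; rfl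
      rw [e]
      exact (ContinuousLinearMap.le_of_opNorm_le _ (Submodule.starProjection_norm_le _) x).trans
        (by simp)
    have h3 : (T * (V n).starProjection - T) x = - T (x - (V n).starProjection x) := by
      simp
    rw [h3, norm_neg]
    refine h1.trans ?_
    gcongr
  refine isCompactOperator_of_tendsto hlim (Filter.Eventually.of_forall fun n => ?_)
  have : IsCompactOperator ((V n).starProjection) := by
    have hp := FiniteDimensional.proper_rclike ℂ (V n)
    have h : IsCompactOperator ((V n).orthogonalProjectionOnto : E →L[ℂ] V n) :=
      isCompactOperator_of_locallyCompactSpace_dom ((V n).orthogonalProjectionOnto)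
    exact h.clm_comp (V n).subtypeL
  exact this.clm_comp T

theorem absPow_nonneg (T : E →L[ℂ] E) (p : ℝ) (x : E) :
    0 ≤ Complex.re (inner ℂ x (absPowE T p x)) := by
  have h : 0 ≤ absPowE T p := by
    refine cfc_nonneg ?_
    intro y hy
    exact Real.rpow_nonneg (spectrum_nonneg_of_nonneg (star_mul_self_nonneg T) hy) _
  have h2 := (ContinuousLinearMap.nonneg_iff_isPositive _).1 h
  exact h2.re_inner_nonneg_right x

theorem compact_of_trace (T : E →L[ℂ] E) (p : ℝ) (hp : 1 ≤ p) (M : ℝ) (hM : 0 ≤ M)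
    (h : traceE (absPowE T p) ≤ ENNReal.ofReal M) : IsCompactOperator T := by
  apply compact_of_bound
  intro δ hδ
  set R := ‖star T * T‖ with hR
  set η := δ ^ 2 / 2 with hη
  have hη0 : 0 < η := by positivity
  set C := R / η ^ (p / 2) with hC
  have hC0 : 0 ≤ C := by positivity
  have hsc : ∀ x ∈ spectrum ℝ (star T * T), x ≤ η + C * x ^ (p / 2) := by
    intro x hx
    have hx0 : 0 ≤ x := spectrum_nonneg_of_nonneg (star_mul_self_nonneg T) hx
    have hxR : x ≤ R := (le_abs_self x).trans ((spectrum.norm_le_norm_mul_of_mem hx).trans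
      (mul_le_of_le_one_right (norm_nonneg _) ContinuousLinearMap.norm_id_le))
    have hxp : 0 ≤ x ^ (p / 2) := Real.rpow_nonneg hx0 _
    rcases le_total x η with hle | hle
    · nlinarith [mul_nonneg hC0 hxp]
    · have h1 : η ^ (p / 2) ≤ x ^ (p / 2) := Real.rpow_le_rpow hη0.le hle (by linarith)
      have h2 : 0 < η ^ (p / 2) := Real.rpow_pos_of_pos hη0 _
      have h3 : R = C * η ^ (p / 2) := by rw [hC]; field_simp
      nlinarith [mul_le_mul_of_nonneg_left h1 hC0]
  have hcont : Continuous fun x : ℝ => x ^ (p / 2) := Real.continuous_rpow_const (by linarith)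
  have hsa : IsSelfAdjoint (star T * T) := IsSelfAdjoint.star_mul_self T
  have hcont2 : Continuous fun x : ℝ => C * x ^ (p / 2) := continuous_const.mul hcont
  have hcont3 : Continuous fun x : ℝ => η + C * x ^ (p / 2) := continuous_const.add hcont2
  have hop : star T * T ≤ η • (1 : E →L[ℂ] E) + C • absPowE T p := by
    have h1 := cfc_mono (f := fun x : ℝ => x) (a := star T * T) hsc (by fun_prop)
      hcont3.continuousOn
    rw [cfc_id' ℝ (star T * T), cfc_const_add η _ _ hcont2.continuousOn,
      cfc_const_mul C _ _ hcont.continuousOn, Algebra.algebraMap_eq_smul_one] at h1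
    exact h1
  have hvec : ∀ v : E, ‖v‖ = 1 → ‖T v‖ ^ 2 ≤ η + C * Complex.re (inner ℂ v (absPowE T p v)) := by
    intro v hv
    have h1 := (ContinuousLinearMap.le_def _ _).1 hop
    have h2 := h1.re_inner_nonneg_right v
    rw [ContinuousLinearMap.sub_apply, inner_sub_right, inner_star_mul,
      inner_self_eq_norm_sq_to_K] at h2
    have e1 : inner ℂ v ((η • (1 : E →L[ℂ] E) + C • absPowE T p) v) =
        (η : ℂ) + (C : ℂ) * inner ℂ v (absPowE T p v) := by
      rw [ContinuousLinearMap.add_apply, inner_add_right, ContinuousLinearMap.smul_apply,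
        ContinuousLinearMap.smul_apply, ContinuousLinearMap.one_apply]
      rw [← Complex.coe_smul, ← Complex.coe_smul, inner_smul_right, inner_smul_right,
        inner_self_eq_norm_sq_to_K, hv]
      simp
    rw [e1] at h2
    have e2 : ((‖T v‖ : ℂ) ^ 2) = ((‖T v‖ ^ 2 : ℝ) : ℂ) := by push_cast; rfl
    simp only [map_sub, map_add] at h2
    have e3 : RCLike.re ((RCLike.ofReal ‖T v‖ : ℂ) ^ 2) = ‖T v‖ ^ 2 := by
      have : ((RCLike.ofReal ‖T v‖ : ℂ) ^ 2) = ((‖T v‖ ^ 2 : ℝ) : ℂ) := by push_cast; rfl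
      rw [this]; exact Complex.ofReal_re _
    have e4 : RCLike.re ((C : ℂ) * inner ℂ v (absPowE T p v)) =
        C * Complex.re (inner ℂ v (absPowE T p v)) := Complex.re_ofReal_mul _ _
    have e5 : RCLike.re (η : ℂ) = η := Complex.ofReal_re _
    rw [e3, e4, e5] at h2
    linarith
  refine ⟨⌈C * M / η⌉₊, ?_⟩
  intro k v hv hvδ _
  have h1 := trace_ge_real (absPowE T p) M hM (absPow_nonneg T p) h v hv Finset.univ
  have h2 : (k : ℝ) * δ ^ 2 ≤ k * η + C * M := by
    calc (k : ℝ) * δ ^ 2 = ∑ i : Fin k, δ ^ 2 := by simp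
      _ ≤ ∑ i : Fin k, (η + C * Complex.re (inner ℂ (v i) (absPowE T p (v i)))) := by
          refine Finset.sum_le_sum fun i _ => ?_
          refine le_trans ?_ (hvec (v i) (hv.1 i))
          exact pow_le_pow_left₀ hδ.le (hvδ i).le 2
      _ = k * η + C * ∑ i : Fin k, Complex.re (inner ℂ (v i) (absPowE T p (v i))) := by
          rw [Finset.sum_add_distrib, Finset.mul_sum]; simp
      _ ≤ _ := by gcongr
  have h3 : (k : ℝ) ≤ C * M / η := by
    rw [le_div_iff₀ hη0]
    have : δ ^ 2 = 2 * η := by rw [hη]; ring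
    rw [this] at h2
    linarith
  exact_mod_cast h3.trans (Nat.le_ceil _)

theorem Bessel.norm_le {ι : Type*} [Fintype ι] {e : ι → E} (he : Bessel e) (i : ι) :
    ‖e i‖ ≤ 1 := by
  have h1 : ‖inner ℂ (e i) (e i)‖ ^ 2 ≤ ‖e i‖ ^ 2 :=
    (Finset.single_le_sum (f := fun j => ‖inner ℂ (e j) (e i)‖ ^ 2)
      (fun j _ => by positivity) (Finset.mem_univ i)).trans (he (e i))
  have h2 : ‖inner ℂ (e i) (e i)‖ = ‖e i‖ ^ 2 := by
    rw [inner_self_eq_norm_sq_to_K]; simp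
  rw [h2] at h1
  by_contra! hcon
  have h3 : 1 < ‖e i‖ ^ 2 := by nlinarith
  have : ‖e i‖ ^ 2 < (‖e i‖ ^ 2) ^ 2 := by nlinarith
  linarith

theorem upper (T : E →L[ℂ] E) (p : ℝ) (hp : 1 ≤ p) (M : ℝ) (hM : 0 ≤ M)
    (h : traceE (absPowE T p) ≤ ENNReal.ofReal M) {k : ℕ} (e f : Fin k → E)
    (he : Bessel e) (hf : Bessel f) :
    ∑ i, ‖inner ℂ (e i) (T (f i))‖ ^ p ≤ M := by
  have hp0 : 0 ≤ p := by linarith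
  obtain ⟨ι, b, hb, ho⟩ := svd T (compact_of_trace T p hp M hM h)
  have hs : ∀ J : Finset ι, ∑ j ∈ J, ‖T (b j)‖ ^ p ≤ M := by
    intro J
    have h1 := trace_ge_real (absPowE T p) M hM (absPow_nonneg T p) h b b.orthonormal J
    refine le_trans (le_of_eq (Finset.sum_congr rfl fun j _ => ?_)) h1
    rw [absPow_eigen T p hp0 (b j) (hb j), inner_smul_right, inner_self_eq_norm_sq_to_K,
      b.orthonormal.1 j, Complex.re_ofReal_mul]
    simp
  set u : ι → E := fun j => ((‖T (b j)‖⁻¹ : ℝ) : ℂ) • T (b j) with hu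
  have hun : ∀ j, ‖u j‖ ≤ 1 := by
    intro j
    simp only [hu, norm_smul, Complex.norm_real, norm_inv, norm_norm]
    exact inv_mul_le_one
  have huo : ∀ i j, i ≠ j → inner ℂ (u i) (u j) = 0 := by
    intro i j hij
    simp only [hu, inner_smul_left, inner_smul_right, ho i j hij, mul_zero]
  have hTu : ∀ j, T (b j) = (‖T (b j)‖ : ℂ) • u j := by
    intro j
    simp only [hu, smul_smul]
    by_cases h0 : T (b j) = 0
    · simp [h0]
    · have : (‖T (b j)‖ : ℂ) ≠ 0 := by simpa using h0
      push_cast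
      rw [mul_inv_cancel₀ this, one_smul]
  -- finite truncations
  have hfin : ∀ J : Finset ι,
      ∑ i, ‖∑ j ∈ J, inner ℂ (b j) (f i) * inner ℂ (e i) (T (b j))‖ ^ p ≤ M := by
    intro J
    set a : Fin k → ι → ℝ := fun i j => ‖inner ℂ (b j) (f i)‖ * ‖inner ℂ (e i) (u j)‖ with ha
    have hw := weight_ineq Finset.univ J hp a (fun j => ‖T (b j)‖)
      (fun i j => by positivity) (fun j => norm_nonneg _)
      (by
        intro i _
        have h1 := Finset.sum_mul_sq_le_sq_mul_sq J (fun j => ‖inner ℂ (b j) (f i)‖)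
          (fun j => ‖inner ℂ (e i) (u j)‖)
        have h2 := b.orthonormal.sum_inner_products_le (f i) (s := J)
        have h3 := bessel_orth J u huo hun (e i)
        simp only [norm_inner_symm _ (e i)] at h3
        have h4 : ‖f i‖ ^ 2 ≤ 1 := pow_le_one₀ (norm_nonneg _) (hf.norm_le i)
        have h5 : ‖e i‖ ^ 2 ≤ 1 := pow_le_one₀ (norm_nonneg _) (he.norm_le i)
        refine (sq_le_one_iff₀ (Finset.sum_nonneg fun _ _ => by positivity)).1 (h1.trans ?_)
        exact mul_le_one₀ (h2.trans h4) (Finset.sum_nonneg fun _ _ => by positivity)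
          (h3.trans h5))
      (by
        intro j _
        have h1 := Finset.sum_mul_sq_le_sq_mul_sq Finset.univ (fun i => ‖inner ℂ (b j) (f i)‖)
          (fun i => ‖inner ℂ (e i) (u j)‖)
        have h2 := hf (b j)
        simp only [norm_inner_symm _ (b j)] at h2
        have h3 := he (u j)
        have h4 : ‖b j‖ ^ 2 ≤ 1 := by rw [b.orthonormal.1 j]; simp
        have h5 : ‖u j‖ ^ 2 ≤ 1 := pow_le_one₀ (norm_nonneg _) (hun j)
        refine (sq_le_one_iff₀ (Finset.sum_nonneg fun _ _ => by positivity)).1 (h1.trans ?_)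
        exact mul_le_one₀ (h2.trans h4) (Finset.sum_nonneg fun _ _ => by positivity)
          (h3.trans h5))
    refine (Finset.sum_le_sum fun i _ => ?_).trans (hw.trans (hs J))
    refine Real.rpow_le_rpow (norm_nonneg _) ?_ hp0
    refine (norm_sum_le _ _).trans (Finset.sum_le_sum fun j _ => ?_)
    conv_lhs => rw [hTu j]
    rw [inner_smul_right]
    simp only [ha, norm_mul, Complex.norm_real, norm_norm]
    exact le_of_eq (by ring)
  have hlim : Filter.Tendsto (fun J : Finset ι =>
      ∑ i, ‖∑ j ∈ J, inner ℂ (b j) (f i) * inner ℂ (e i) (T (b j))‖ ^ p) Filter.atTop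
      (nhds (∑ i, ‖inner ℂ (e i) (T (f i))‖ ^ p)) := by
    refine tendsto_finsetSum _ fun i _ => ?_
    have h1 := (b.hasSum_repr (f i)).mapL ((innerSL ℂ (e i)).comp T)
    have h2 : HasSum (fun j => inner ℂ (b j) (f i) * inner ℂ (e i) (T (b j)))
        (inner ℂ (e i) (T (f i))) := by
      have e1 : (fun j => inner ℂ (b j) (f i) * inner ℂ (e i) (T (b j))) =
          fun j => ((innerSL ℂ (e i)).comp T) (b.repr (f i) j • b j) := by
        funext j
        rw [map_smul, b.repr_apply_apply]
        rfl
      rw [e1]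
      exact h1
    exact (Real.continuous_rpow_const hp0).continuousAt.tendsto.comp
      (continuous_norm.continuousAt.tendsto.comp h2)
  exact le_of_tendsto hlim (Filter.Eventually.of_forall hfin)

theorem HasSum.congr_fun' {ι : Type*} {f g : ι → ℝ} {a : ℝ} (h : HasSum g a)
    (e : ∀ j, f j = g j) : HasSum f a := by
  rw [show f = g from funext e]
  exact h

theorem lower (T : E →L[ℂ] E) (p : ℝ) (hp : 1 ≤ p) (M : ℝ)
    (H : ∀ (k : ℕ) (e f : Fin k → E), Bessel e → Bessel f →
      ∑ i, ‖inner ℂ (e i) (T (f i))‖ ^ p ≤ M) :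
    traceE (absPowE T p) ≤ ENNReal.ofReal M := by
  have hp0 : 0 ≤ p := by linarith
  have hNorm : ∀ x : E, inner ℂ (((‖x‖⁻¹ : ℝ) : ℂ) • x) x = (‖x‖ : ℂ) := by
    intro x
    by_cases h0 : x = 0
    · simp [h0]
    · have : (‖x‖ : ℂ) ≠ 0 := by simpa using h0
      rw [inner_smul_left, inner_self_eq_norm_sq_to_K, Complex.conj_ofReal]
      push_cast
      change (‖x‖ : ℂ)⁻¹ * (‖x‖ : ℂ) ^ 2 = _
      field_simp
  have hNle : ∀ x : E, ‖((‖x‖⁻¹ : ℝ) : ℂ) • x‖ ≤ 1 := by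
    intro x
    simp only [norm_smul, Complex.norm_real, norm_inv, norm_norm]
    exact inv_mul_le_one
  have hfam : ∀ (k : ℕ) (v : Fin k → E), Orthonormal ℂ v →
      (∀ i j, i ≠ j → inner ℂ (T (v i)) (T (v j)) = 0) → ∑ i, ‖T (v i)‖ ^ p ≤ M := by
    intro k v hv hvo
    have h1 := H k (fun i => ((‖T (v i)‖⁻¹ : ℝ) : ℂ) • T (v i)) v
      (fun x => bessel_orth Finset.univ _ (fun i j hij => by
        rw [inner_smul_left, inner_smul_right, hvo i j hij, mul_zero, mul_zero])
        (fun i => hNle _) x)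
      (fun x => hv.sum_inner_products_le x)
    simp only [hNorm, Complex.norm_real, norm_norm] at h1
    exact h1
  have hcomp : IsCompactOperator T := by
    apply compact_of_bound
    intro δ hδ
    refine ⟨⌈M / δ ^ p⌉₊, ?_⟩
    intro k v hv hvδ hvo
    have h1 := hfam k v hv hvo
    have h2 : (k : ℝ) * δ ^ p ≤ M := by
      refine le_trans ?_ h1
      calc (k : ℝ) * δ ^ p = ∑ i : Fin k, δ ^ p := by simp
        _ ≤ _ := Finset.sum_le_sum fun i _ => Real.rpow_le_rpow hδ.le (hvδ i).le hp0
    have h3 : (k : ℝ) ≤ M / δ ^ p := by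
      rwa [le_div_iff₀ (Real.rpow_pos_of_pos hδ p)]
    exact_mod_cast h3.trans (Nat.le_ceil _)
  obtain ⟨ι, b, hb, ho⟩ := svd T hcomp
  have hs : ∀ J : Finset ι, ∑ j ∈ J, ‖T (b j)‖ ^ p ≤ M := by
    intro J
    have hinj : Function.Injective fun i : Fin J.card => ((J.equivFin.symm i : J) : ι) :=
      Subtype.val_injective.comp J.equivFin.symm.injective
    have h1 := hfam J.card (fun i => b (J.equivFin.symm i : J)) (b.orthonormal.comp _ hinj)
      (fun i j hij => ho _ _ (fun h => hij (hinj h)))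
    rw [Equiv.sum_comp J.equivFin.symm (fun j : J => ‖T (b j)‖ ^ p),
      Finset.sum_coe_sort J (fun j => ‖T (b j)‖ ^ p)] at h1
    exact h1
  unfold traceE
  refine iSup₂_le fun s hon => ?_
  rw [← ENNReal.ofReal_sum_of_nonneg fun v _ => absPow_nonneg T p v]
  refine ENNReal.ofReal_le_ofReal ?_
  have hsum : ∀ v : E, HasSum (fun j => ‖T (b j)‖ ^ p * ‖inner ℂ (b j) v‖ ^ 2)
      (Complex.re (inner ℂ v (absPowE T p v))) := by
    intro v
    have h1 := (b.hasSum_inner_mul_inner v (absPowE T p v)).mapL Complex.reCLM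
    refine HasSum.congr_fun' h1 fun j => ?_
    have h2 : inner ℂ (b j) (absPowE T p v) = (‖T (b j)‖ ^ p : ℝ) * inner ℂ (b j) v := by
      rw [← ContinuousLinearMap.adjoint_inner_left, ← ContinuousLinearMap.star_eq_adjoint,
        (absPow_selfAdjoint T p).star_eq, absPow_eigen T p hp0 (b j) (hb j), inner_smul_left,
        Complex.conj_ofReal]
    rw [h2]
    have h3 : inner ℂ v (b j) * (((‖T (b j)‖ ^ p : ℝ) : ℂ) * inner ℂ (b j) v) =
        ((‖T (b j)‖ ^ p * ‖inner ℂ (b j) v‖ ^ 2 : ℝ) : ℂ) := by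
      rw [← inner_conj_symm v (b j), mul_left_comm, RCLike.conj_mul]
      push_cast
      rfl
    rw [h3]
    exact (Complex.ofReal_re _).symm
  have hS := hasSum_sum (s := s) (fun v _ => hsum v)
  refine le_of_tendsto hS (Filter.Eventually.of_forall fun J => ?_)
  refine le_trans (Finset.sum_le_sum fun j _ => ?_) (hs J)
  rw [← Finset.mul_sum]
  refine mul_le_of_le_one_right (Real.rpow_nonneg (norm_nonneg _) _) ?_
  have h1 := hon.sum_inner_products_le (b j) (s := Finset.univ)
  rw [Finset.sum_coe_sort s (fun v => ‖inner ℂ v (b j)‖ ^ 2), b.orthonormal.1 j] at h1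
  simp only [norm_inner_symm _ (b j)] at h1
  simpa using h1

theorem Bd_top (T : E →L[ℂ] E) : Bd ∞ T ‖T‖ := by
  intro k e f he hf
  rw [PiLp.norm_eq_ciSup]
  refine Real.iSup_le (fun i => ?_) (norm_nonneg _)
  rw [Phi_apply]
  have h1 := he.norm_le i
  have h2 := hf.norm_le i
  calc ‖inner ℂ (e i) (T (f i))‖ ≤ ‖e i‖ * ‖T (f i)‖ := norm_inner_le_norm _ _
    _ ≤ 1 * (‖T‖ * 1) := by
        gcongr
        exact (T.le_opNorm _).trans (by gcongr)
    _ = ‖T‖ := by ring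

theorem bessel_one (x : E) (hx : ‖x‖ ≤ 1) : Bessel (fun _ : Fin 1 => x) := by
  intro y
  simp only [Finset.univ_unique, Finset.sum_const, Finset.card_singleton, one_smul]
  have : ‖inner ℂ x y‖ ≤ 1 * ‖y‖ := (norm_inner_le_norm _ _).trans (by gcongr)
  rw [one_mul] at this
  gcongr

theorem norm_unit_le (x : E) : ‖((‖x‖⁻¹ : ℝ) : ℂ) • x‖ ≤ 1 := by
  rw [norm_smul, Complex.norm_real, norm_inv, norm_norm]
  exact inv_mul_le_one

theorem inner_unit (x : E) : inner ℂ (((‖x‖⁻¹ : ℝ) : ℂ) • x) x = (‖x‖ : ℂ) := by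
  by_cases h0 : x = 0
  · simp [h0]
  · have : (‖x‖ : ℂ) ≠ 0 := by simpa using h0
    rw [inner_smul_left, inner_self_eq_norm_sq_to_K, Complex.conj_ofReal]
    push_cast
    change (‖x‖ : ℂ)⁻¹ * (‖x‖ : ℂ) ^ 2 = _
    field_simp

theorem norm_le_of_Bd_top (T : E →L[ℂ] E) (M : ℝ) (h : Bd ∞ T M) : ‖T‖ ≤ M := by
  refine T.opNorm_le_bound h.nonneg fun x => ?_
  by_cases h0 : x = 0
  · simp [h0]
  have h1 := h 1 _ _ (bessel_one _ (norm_unit_le (T x))) (bessel_one _ (norm_unit_le x))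
  rw [PiLp.norm_eq_ciSup] at h1
  have h2 := (le_ciSup (Set.finite_range _).bddAbove (0 : Fin 1)).trans h1
  rw [Phi_apply, map_smul, inner_smul_right, inner_unit, norm_mul, Complex.norm_real,
    Complex.norm_real, norm_inv, norm_norm, norm_norm] at h2
  have h3 : 0 < ‖x‖ := norm_pos_iff.2 h0
  rwa [inv_mul_le_iff₀ h3, mul_comm] at h2

theorem norm_Phi_le_iff {p : ℝ≥0∞} [Fact (1 ≤ p)] (hp : 0 < p.toReal) {k : ℕ}
    (e f : Fin k → E) (T : E →L[ℂ] E) (M : ℝ) (hM : 0 ≤ M) :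
    ‖Phi p e f T‖ ≤ M ↔
      ∑ i, ‖inner ℂ (e i) (T (f i))‖ ^ p.toReal ≤ M ^ p.toReal := by
  rw [PiLp.norm_eq_sum hp]
  simp only [Phi_apply]
  have h0 : 0 ≤ ∑ i, ‖inner ℂ (e i) (T (f i))‖ ^ p.toReal :=
    Finset.sum_nonneg fun i _ => Real.rpow_nonneg (norm_nonneg _) _
  rw [one_div, Real.rpow_inv_le_iff_of_pos h0 hM hp]

theorem Bd_iff {p : ℝ≥0∞} [hp : Fact (1 ≤ p)] (T : E →L[ℂ] E) (M : ℝ) (hM : 0 ≤ M) :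
    Bd p T M ↔ schattenE p T ≤ ENNReal.ofReal M := by
  by_cases htop : p = ∞
  · subst htop
    have e1 : schattenE ∞ T = ENNReal.ofReal ‖T‖ := by
      rw [schattenE, if_pos rfl, ofReal_norm_eq_enorm]
      rfl
    rw [e1, ENNReal.ofReal_le_ofReal_iff hM]
    exact ⟨norm_le_of_Bd_top T M, fun h k e f he hf => (Bd_top T k e f he hf).trans h⟩
  · have h1 : 1 ≤ p.toReal := by
      have := ENNReal.toReal_mono htop hp.out
      simpa using this
    have h0 : 0 < p.toReal := by linarith
    rw [schattenE, if_neg htop, one_div, ENNReal.rpow_inv_le_iff h0,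
      ENNReal.ofReal_rpow_of_nonneg hM h0.le]
    constructor
    · intro h
      refine lower T _ h1 _ fun k e f he hf => ?_
      exact (norm_Phi_le_iff h0 e f T M hM).1 (h k e f he hf)
    · intro h k e f he hf
      rw [norm_Phi_le_iff h0 e f T M hM]
      exact upper T _ h1 _ (Real.rpow_nonneg hM _) h e f he hf

theorem schatten_unmix (p : ℝ≥0∞) (hp : 1 ≤ p) (n m : ℕ) (A B : E →L[ℂ] E)
    (hA : IsSelfAdjoint A) (hB : IsSelfAdjoint B) :
    schattenE p (B ^ n * A * B ^ m) ≤ schattenE p (A * B ^ (n + m)) := by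
  have : Fact (1 ≤ p) := ⟨hp⟩
  by_cases h : schattenE p (A * B ^ (n + m)) = ∞
  · rw [h]
    exact le_top
  · have e1 := ENNReal.ofReal_toReal h
    have h1 := (Bd_iff (p := p) (A * B ^ (n + m)) _ ENNReal.toReal_nonneg).2 e1.ge
    have h2 := Bd_unmix A B hA hB n m _ h1
    have h3 := (Bd_iff _ _ ENNReal.toReal_nonneg).1 h2
    rwa [e1] at h3

end Aux

/-- **Unmixing inequality** (Lemma 2.6).  Let `H` be a separable Hilbert space,
`p ∈ [1,∞]`, `n, m ∈ ℕ`, and let `A`, `B` be bounded self-adjoint operators on `H`.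
Then `‖Bⁿ A Bᵐ‖_p ≤ 2 ‖A B^{n+m}‖_p`, where `‖·‖_p` is the Schatten `p`-norm
(with the value `+∞` allowed, and `‖·‖_∞` the operator norm).  If moreover `A ≥ 0`,
then the sharper bound `‖Bⁿ A Bᵐ‖_p ≤ ‖A B^{n+m}‖_p` holds. -/
theorem unmixing_inequality [CompleteSpace E] [TopologicalSpace.SeparableSpace E]
    (p : ℝ≥0∞) (hp : 1 ≤ p) (n m : ℕ) (A B : E →L[ℂ] E)
    (hA : IsSelfAdjoint A) (hB : IsSelfAdjoint B) :
    schattenE p (B ^ n * A * B ^ m) ≤ 2 * schattenE p (A * B ^ (n + m)) ∧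
      (A.IsPositive →
        schattenE p (B ^ n * A * B ^ m) ≤ schattenE p (A * B ^ (n + m))) := by
  have hmain := schatten_unmix p hp n m A B hA hB
  exact ⟨hmain.trans (le_mul_of_one_le_left zero_le one_le_two), fun _ => hmain⟩

end
end

section
/- Let H be a separable Hilbert space, n ∈ ℕ, p ∈ [1,∞], and let A, B be bounded self-adjoint operators on H. Denote by ad_B the map ad_B(A) := [B, A] = BA − AB, and by ad_B^n its n-th iterate. Then ‖ad_B^n(A)‖_p ≤ 2^{n+1} ‖A Bⁿ‖_p, where ‖·‖_p is the Schatten p-norm (value +∞ allowed; operator norm for p = ∞). -/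
noncomputable section

open MeasureTheory Complex ENNReal NNReal
open scoped Classical

variable {E : Type*} [NormedAddCommGroup E] [InnerProductSpace ℂ E]

/-- The `n`-th iterated adjoint action `ad_B^n (A)`, where `ad_B (A) = [B, A] = BA - AB`. -/
def adIter (B : E →L[ℂ] E) (n : ℕ) (A : E →L[ℂ] E) : E →L[ℂ] E :=
  (fun X => B * X - X * B)^[n] A

section Helpers

universe u

open scoped InnerProductSpace

variable {H : Type u} [NormedAddCommGroup H] [InnerProductSpace ℂ H]

/-- The vector of matrix entries. -/
def entries (p : ℝ≥0∞) {ι : Type u} (T : H →L[ℂ] H) (e f : ι → H) :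
    PiLp p (fun _ : ι => ℂ) :=
  WithLp.toLp p (fun i => inner ℂ (f i) (T (e i)))

/-- `T` has all matrix diagonals bounded in `ℓ^p` by `M`. -/
def SB (p : ℝ≥0∞) [Fact (1 ≤ p)] (T : H →L[ℂ] H) (M : ℝ) : Prop :=
  ∀ (ι : Type u) [Fintype ι] (e f : ι → H), Orthonormal ℂ e → Orthonormal ℂ f →
    ‖entries p T e f‖ ≤ M

variable {p : ℝ≥0∞} [Fact (1 ≤ p)]

theorem entries_add {ι : Type u} (S T : H →L[ℂ] H) (e f : ι → H) :
    entries p (S + T) e f = entries p S e f + entries p T e f := by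
  ext i; simp [entries, inner_add_right]

theorem entries_smul {ι : Type u} (c : ℂ) (T : H →L[ℂ] H) (e f : ι → H) :
    entries p (c • T) e f = c • entries p T e f := by
  ext i; simp [entries, inner_smul_right]

theorem SB.add {S T : H →L[ℂ] H} {M N : ℝ} (hS : SB p S M) (hT : SB p T N) :
    SB p (S + T) (M + N) := by
  intro ι _ e f he hf
  rw [entries_add]
  exact (norm_add_le _ _).trans (add_le_add (hS ι e f he hf) (hT ι e f he hf))

theorem SB.smul {T : H →L[ℂ] H} {M : ℝ} (c : ℂ) (hT : SB p T M) :
    SB p (c • T) (‖c‖ * M) := by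
  intro ι _ e f he hf
  rw [entries_smul, norm_smul]
  exact mul_le_mul_of_nonneg_left (hT ι e f he hf) (norm_nonneg _)

theorem SB.sub {S T : H →L[ℂ] H} {M N : ℝ} (hS : SB p S M) (hT : SB p T N) :
    SB p (S - T) (M + N) := by
  have := hS.add (hT.smul (-1))
  simpa [sub_eq_add_neg] using this

theorem SB.mono {T : H →L[ℂ] H} {M N : ℝ} (hT : SB p T M) (h : M ≤ N) : SB p T N :=
  fun ι _ e f he hf => (hT ι e f he hf).trans h

theorem PiLp_norm_congr {ι : Type u} [Fintype ι] (x y : PiLp p (fun _ : ι => ℂ))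
    (h : ∀ i, ‖x i‖ = ‖y i‖) : ‖x‖ = ‖y‖ := by
  rcases eq_or_ne p ∞ with rfl | hp
  · simp [PiLp.norm_eq_ciSup, h]
  · have h0 : 0 < p.toReal :=
      ENNReal.toReal_pos (zero_lt_one.trans_le (Fact.out : 1 ≤ p)).ne' hp
    simp [PiLp.norm_eq_sum h0, h]

variable [CompleteSpace H]

theorem SB.adj {T : H →L[ℂ] H} {M : ℝ} (hT : SB p T M) : SB p (star T) M := by
  intro ι _ e f he hf
  refine le_trans (le_of_eq ?_) (hT ι f e hf he)
  apply PiLp_norm_congr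
  intro i
  simp only [entries, ContinuousLinearMap.star_eq_adjoint]
  rw [ContinuousLinearMap.adjoint_inner_right, ← inner_conj_symm, RCLike.norm_conj]

theorem orthonormal_unitary {U : H →L[ℂ] H} (hU : U ∈ unitary (H →L[ℂ] H)) {ι : Type u}
    {e : ι → H} (he : Orthonormal ℂ e) : Orthonormal ℂ (fun i => U (e i)) := by
  have h1 : star U * U = 1 := (Unitary.mem_iff.1 hU).1
  have key : ∀ x y : H, inner ℂ (U x) (U y) = inner ℂ x y := by
    intro x y
    rw [← ContinuousLinearMap.adjoint_inner_right, ← ContinuousLinearMap.star_eq_adjoint,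
      ← mul_apply_eq_comp, h1, one_apply_eq_self]
  rw [orthonormal_iff_ite] at he ⊢
  intro i j
  rw [key, he]

theorem SB.mul_unitary {T U : H →L[ℂ] H} {M : ℝ} (hT : SB p T M)
    (hU : U ∈ unitary (H →L[ℂ] H)) : SB p (T * U) M :=
  fun ι _ e f he hf => hT ι (fun i => U (e i)) f (orthonormal_unitary hU he) hf

theorem SB.unitary_mul {T U : H →L[ℂ] H} {M : ℝ} (hT : SB p T M)
    (hU : U ∈ unitary (H →L[ℂ] H)) : SB p (U * T) M := by
  have := (hT.adj.mul_unitary (Unitary.star_mem hU)).adj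
  simpa using this

theorem SB.mul_contr {T K : H →L[ℂ] H} {M : ℝ} (hT : SB p T M)
    (hK : IsSelfAdjoint K) (hK1 : ‖K‖ ≤ 1) : SB p (T * K) M := by
  have hU := hK.self_add_I_smul_cfcSqrt_sub_sq_mem_unitary K hK1
  set S := CFC.sqrt (1 - K ^ 2)
  have hS : IsSelfAdjoint S := (CFC.sqrt_nonneg (1 - K ^ 2)).isSelfAdjoint
  have h := ((hT.mul_unitary hU).add (hT.mul_unitary (Unitary.star_mem hU))).smul (1/2 : ℂ)
  have e1 : (1/2 : ℂ) • (T * (K + Complex.I • S) + T * star (K + Complex.I • S)) = T * K := by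
    rw [← mul_add, star_add, star_smul, hK.star_eq, hS.star_eq]
    have : K + Complex.I • S + (K + Star.star Complex.I • S) = (2 : ℂ) • K := by
      rw [two_smul]; simp; abel
    rw [this, mul_smul_comm, smul_smul]; norm_num
  rw [e1] at h
  refine h.mono (le_of_eq ?_)
  norm_num; ring

theorem SB.contr_mul {T K : H →L[ℂ] H} {M : ℝ} (hT : SB p T M)
    (hK : IsSelfAdjoint K) (hK1 : ‖K‖ ≤ 1) : SB p (K * T) M := by
  have := (hT.adj.mul_contr hK hK1).adj
  simpa [hK.star_eq] using this

theorem SB.of_tendsto {T : H →L[ℂ] H} {M : ℝ} {α : Type*} {l : Filter α} [l.NeBot]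
    {F : α → H →L[ℂ] H} (hF : Filter.Tendsto F l (nhds T)) (h : ∀ᶠ a in l, SB p (F a) M) :
    SB p T M := by
  intro ι _ e f he hf
  have hc : Continuous (fun T : H →L[ℂ] H => ‖entries p T e f‖) := by
    unfold entries
    apply Continuous.norm
    apply (PiLp.continuous_toLp p (fun _ : ι => ℂ)).comp
    fun_prop
  refine le_of_tendsto ((hc.tendsto T).comp hF) ?_
  filter_upwards [h] with a ha using ha ι e f he hf

theorem exp_imag_unitary {L : H →L[ℂ] H} (hL : IsSelfAdjoint L) (z : ℂ) (hz : z.re = 0) :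
    NormedSpace.exp (z • L) ∈ unitary (H →L[ℂ] H) := by
  letI : NormedAlgebra ℚ (H →L[ℂ] H) := NormedAlgebra.restrictScalars ℚ ℂ (H →L[ℂ] H)
  apply NormedSpace.exp_mem_unitary_of_mem_skewAdjoint
  rw [skewAdjoint.mem_iff, star_smul, hL.star_eq, ← neg_smul]
  congr 1
  apply Complex.ext <;> simp [hz]

theorem exp_add_smul (L : H →L[ℂ] H) (z w : ℂ) :
    NormedSpace.exp ((z + w) • L) = NormedSpace.exp (z • L) * NormedSpace.exp (w • L) := by
  letI : NormedAlgebra ℚ (H →L[ℂ] H) := NormedAlgebra.restrictScalars ℚ ℂ (H →L[ℂ] H)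
  rw [add_smul]
  exact NormedSpace.exp_add_of_commute (((Commute.refl L).smul_left z).smul_right w)

theorem exp_norm_bound {L : H →L[ℂ] H} (hL : IsSelfAdjoint L) :
    ∃ C : ℝ, 0 ≤ C ∧ ∀ z : ℂ, |z.re| ≤ 1 → ‖NormedSpace.exp (z • L)‖ ≤ C := by
  have hd1 : Differentiable ℂ (fun z : ℂ => NormedSpace.exp (z • L)) :=
    fun z => (hasDerivAt_exp_smul_const L z).differentiableAt
  have hcont : Continuous (fun r : ℝ => NormedSpace.exp ((r : ℂ) • L)) :=
    hd1.continuous.comp Complex.continuous_ofReal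
  obtain ⟨C, hC⟩ := (isCompact_Icc (a := (-1 : ℝ)) (b := 1)).exists_bound_of_continuousOn
    hcont.continuousOn
  refine ⟨C, (norm_nonneg _).trans (hC 0 (by simp)), fun z hz => ?_⟩
  rw [← Complex.re_add_im z, exp_add_smul]
  have hu := exp_imag_unitary hL (z.im * Complex.I) (by simp)
  have h1 : ‖NormedSpace.exp (((z.im : ℂ) * Complex.I) • L)‖ ≤ 1 := by
    have := CStarRing.norm_mem_unitary_mul (E := H →L[ℂ] H) 1 hu
    have h2 : ‖(1 : H →L[ℂ] H)‖ ≤ 1 := ContinuousLinearMap.norm_id_le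
    rw [mul_one] at this
    exact this.le.trans h2
  have h3 := hC z.re (abs_le.1 hz)
  calc _ ≤ _ := norm_mul_le _ _
    _ ≤ C * 1 := by
      apply mul_le_mul h3 h1 (norm_nonneg _) ((norm_nonneg _).trans h3)
    _ = _ := mul_one _

theorem SB_three_lines {L A X Y : H →L[ℂ] H} (hL : IsSelfAdjoint L) {M : ℝ} (hM : 0 ≤ M)
    (h0 : ∀ z : ℂ, z.re = 0 → SB p (X * NormedSpace.exp (z • L) * A *
      NormedSpace.exp ((1 - z) • L) * Y) M)
    (h1 : ∀ z : ℂ, z.re = 1 → SB p (X * NormedSpace.exp (z • L) * A *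
      NormedSpace.exp ((1 - z) • L) * Y) M) (z : ℂ) (hz0 : 0 ≤ z.re) (hz1 : z.re ≤ 1) :
    SB p (X * NormedSpace.exp (z • L) * A * NormedSpace.exp ((1 - z) • L) * Y) M := by
  intro ι _ e f he hf
  set F : ℂ → H →L[ℂ] H := fun z => X * NormedSpace.exp (z • L) * A *
    NormedSpace.exp ((1 - z) • L) * Y with hF
  let φ : (H →L[ℂ] H) →ₗ[ℂ] PiLp p (fun _ : ι => ℂ) :=
    { toFun := fun T => entries p T e f
      map_add' := fun S T => entries_add S T e f
      map_smul' := fun c T => entries_smul c T e f }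
  have hc : Continuous φ := by
    change Continuous (fun T : H →L[ℂ] H => entries p T e f)
    unfold entries
    apply (PiLp.continuous_toLp p (fun _ : ι => ℂ)).comp
    fun_prop
  let Φ : (H →L[ℂ] H) →L[ℂ] PiLp p (fun _ : ι => ℂ) := ⟨φ, hc⟩
  have hd1 : Differentiable ℂ (fun z : ℂ => NormedSpace.exp (z • L)) :=
    fun z => (hasDerivAt_exp_smul_const L z).differentiableAt
  have hd2 : Differentiable ℂ (fun z : ℂ => NormedSpace.exp ((1 - z) • L)) :=
    hd1.comp (by fun_prop : Differentiable ℂ (fun z : ℂ => 1 - z))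
  have hd : Differentiable ℂ F := by
    intro z
    exact ((((differentiableAt_const X).mul (hd1 z)).mul (differentiableAt_const A)).mul
      (hd2 z)).mul (differentiableAt_const Y)
  have hdΦ : Differentiable ℂ (fun z => Φ (F z)) := Φ.differentiable.comp hd
  have key := Complex.HadamardThreeLines.norm_le_interp_of_mem_verticalClosedStrip₀₁'
    (fun z => Φ (F z)) (z := z) (a := M) (b := M) ⟨hz0, hz1⟩ hdΦ.diffContOnCl ?_ ?_ ?_
  · refine (key.trans (le_of_eq ?_))
    rcases hM.eq_or_lt with h | h
    · subst h
      by_cases hz : z.re = 0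
      · simp [hz]
      · simp [Real.zero_rpow hz]
    · rw [← Real.rpow_add h]; simp
  · obtain ⟨C, hC0, hC⟩ := exp_norm_bound hL
    refine ⟨‖Φ‖ * (‖X‖ * C * ‖A‖ * C * ‖Y‖), ?_⟩
    rintro _ ⟨w, hw, rfl⟩
    have hw0 : 0 ≤ w.re := hw.1
    have hw1 : w.re ≤ 1 := hw.2
    refine (Φ.le_opNorm _).trans ?_
    gcongr
    have b1 := hC w (abs_le.2 ⟨by linarith, hw1⟩)
    have b2 := hC (1 - w) (abs_le.2 ⟨by simp; linarith, by simp; linarith⟩)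
    simp only [hF]
    refine (norm_mul_le _ _).trans ?_
    gcongr
    refine (norm_mul_le _ _).trans ?_
    gcongr
    refine (norm_mul_le _ _).trans ?_
    gcongr
    refine (norm_mul_le _ _).trans ?_
    gcongr
  · intro w hw
    exact h0 w hw ι e f he hf
  · intro w hw
    exact h1 w hw ι e f he hf

theorem exists_reg {B : H →L[ℂ] H} (hB : IsSelfAdjoint B) {ε : ℝ} (hε : 0 < ε) :
    ∃ L K : H →L[ℂ] H, IsSelfAdjoint L ∧ IsSelfAdjoint K ∧ ‖K‖ ≤ 1 ∧ Commute K L ∧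
      K * NormedSpace.exp L = B ∧ ‖K * K * B - B‖ ≤ ε := by
  have hpos : ∀ x : ℝ, 0 < x ^ 2 + ε ^ 2 := fun x => by positivity
  have hs : ∀ x : ℝ, 0 < √(x ^ 2 + ε ^ 2) := fun x => Real.sqrt_pos.2 (hpos x)
  have c1 : Continuous (fun x : ℝ => Real.log √(x ^ 2 + ε ^ 2)) :=
    Continuous.log (by fun_prop) (fun x => (hs x).ne')
  have c2 : Continuous (fun x : ℝ => x / √(x ^ 2 + ε ^ 2)) :=
    Continuous.div (by fun_prop) (by fun_prop) (fun x => (hs x).ne')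
  have hLs : IsSelfAdjoint (cfc (fun x : ℝ => Real.log √(x ^ 2 + ε ^ 2)) B) := cfc_predicate _ B
  refine ⟨cfc (fun x : ℝ => Real.log √(x ^ 2 + ε ^ 2)) B, cfc (fun x : ℝ => x / √(x ^ 2 + ε ^ 2)) B,
    hLs, cfc_predicate _ B, ?_, cfc_commute_cfc _ _ _, ?_, ?_⟩
  · apply norm_cfc_le zero_le_one
    intro x _
    rw [Real.norm_eq_abs, abs_div, abs_of_pos (hs x), div_le_one (hs x)]
    apply Real.abs_le_sqrt
    nlinarith
  · rw [← CFC.real_exp_eq_normedSpace_exp hLs, ← cfc_comp' Real.exp _ B (by fun_prop)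
      c1.continuousOn, ← cfc_mul _ (fun x : ℝ => Real.exp (Real.log √(x ^ 2 + ε ^ 2))) B
      c2.continuousOn (Real.continuous_exp.comp c1).continuousOn]
    conv_rhs => rw [← cfc_id' ℝ B]
    congr 1
    ext x
    rw [Real.exp_log (hs x)]
    field_simp [(hs x).ne']
  · have : cfc (fun x : ℝ => x / √(x ^ 2 + ε ^ 2)) B * cfc (fun x : ℝ => x / √(x ^ 2 + ε ^ 2)) B
        * B - B = cfc (fun x : ℝ => x / √(x ^ 2 + ε ^ 2) * (x / √(x ^ 2 + ε ^ 2)) * x - x) B := by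
      rw [cfc_sub (fun x : ℝ => x / √(x ^ 2 + ε ^ 2) * (x / √(x ^ 2 + ε ^ 2)) * x)
          (fun x : ℝ => x) B ((c2.mul c2).mul continuous_id).continuousOn continuousOn_id,
        cfc_mul (fun x : ℝ => x / √(x ^ 2 + ε ^ 2) * (x / √(x ^ 2 + ε ^ 2)))
          (fun x : ℝ => x) B (c2.mul c2).continuousOn continuousOn_id,
        cfc_mul _ _ B c2.continuousOn c2.continuousOn, cfc_id' ℝ B]
    rw [this]
    apply norm_cfc_le hε.le
    intro x _
    have e1 : x / √(x ^ 2 + ε ^ 2) * (x / √(x ^ 2 + ε ^ 2)) * x - x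
        = - (ε ^ 2 * x / (x ^ 2 + ε ^ 2)) := by
      rw [div_mul_div_comm, Real.mul_self_sqrt (hpos x).le]
      field_simp [(hpos x).ne']
      ring
    rw [e1, norm_neg, Real.norm_eq_abs, abs_div, abs_of_pos (hpos x), div_le_iff₀ (hpos x), abs_mul,
      abs_of_pos (by positivity : 0 < ε ^ 2)]
    nlinarith [mul_nonneg hε.le (sq_nonneg (|x| - ε)), sq_abs x, abs_nonneg x,
      mul_nonneg hε.le (sq_nonneg x), pow_pos hε 3, mul_nonneg (abs_nonneg x) (sq_nonneg ε)]

theorem norm_pow_le_one' {K : H →L[ℂ] H} (hK : ‖K‖ ≤ 1) (j : ℕ) : ‖K ^ j‖ ≤ 1 := by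
  induction j with
  | zero =>
    rw [pow_zero]
    exact ContinuousLinearMap.norm_id_le
  | succ j ih =>
    rw [pow_succ]
    exact (norm_mul_le _ _).trans (mul_le_one₀ ih (norm_nonneg _) hK)

theorem SB_reg {A B L K : H →L[ℂ] H} (hL : IsSelfAdjoint L) (hK : IsSelfAdjoint K)
    (hK1 : ‖K‖ ≤ 1) (hc : Commute K L) (hB : K * NormedSpace.exp L = B)
    {k m : ℕ} (hk : 0 < k) {M : ℝ} (hM : 0 ≤ M)
    (h : SB p (A * B ^ (k + m)) M) (h' : SB p (B ^ (k + m) * A) M) :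
    SB p (K ^ (2 * m) * B ^ k * A * B ^ m * K ^ (2 * k)) M := by
  have hcB : Commute K B := by
    rw [← hB]; exact (Commute.refl K).mul_right hc.exp_right
  have hcE : Commute K (NormedSpace.exp L) := hc.exp_right
  set n := k + m with hn
  have hn0 : (n : ℂ) ≠ 0 := by
    have : n ≠ 0 := by omega
    exact_mod_cast this
  have hBn : ∀ j : ℕ, K ^ j * NormedSpace.exp ((j : ℂ) • L) = B ^ j := by
    intro j
    letI : NormedAlgebra ℚ (H →L[ℂ] H) := NormedAlgebra.restrictScalars ℚ ℂ (H →L[ℂ] H)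
    rw [← hB, hcE.mul_pow, Nat.cast_smul_eq_nsmul, NormedSpace.exp_nsmul]
  have hcz : ∀ (j : ℕ) (z : ℂ), Commute (K ^ j) (NormedSpace.exp (z • L)) := by
    intro j z
    exact ((hc.smul_right z).exp_right).pow_left j
  have hBn' : ∀ j : ℕ, NormedSpace.exp ((j : ℂ) • L) * K ^ j = B ^ j := by
    intro j
    rw [← (hcz j j).eq, hBn]
  have hLn : IsSelfAdjoint ((n : ℂ) • L) := by
    rw [isSelfAdjoint_iff, star_smul, hL.star_eq]; simp
  have hKp : ∀ j, IsSelfAdjoint (K ^ j) := fun j => hK.pow j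
  have key := SB_three_lines (p := p) (L := (n : ℂ) • L) (A := A) (X := K ^ (n + m))
    (Y := K ^ (n + k)) hLn hM ?_ ?_ ((k : ℂ) / n) ?_ ?_
  · have e1 : ((k : ℂ) / n) • (n : ℂ) • L = (k : ℂ) • L := by
      rw [smul_smul, div_mul_cancel₀ _ hn0]
    have e2 : (1 - (k : ℂ) / n) • (n : ℂ) • L = (m : ℂ) • L := by
      rw [smul_smul, sub_mul, div_mul_cancel₀ _ hn0, hn]; push_cast; congr 1; ring
    rw [e1, e2] at key
    have e3 : K ^ (n + m) * NormedSpace.exp ((k : ℂ) • L) = K ^ (2 * m) * B ^ k := by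
      rw [← hBn k, ← mul_assoc, ← pow_add]; congr 2; omega
    have e4 : NormedSpace.exp ((m : ℂ) • L) * K ^ (n + k) = B ^ m * K ^ (2 * k) := by
      rw [← hBn' m, mul_assoc, ← pow_add]; congr 2; omega
    rw [e3, mul_assoc _ (NormedSpace.exp _), e4, ← mul_assoc] at key
    exact key
  · intro z hz
    have hu : NormedSpace.exp (z • (n : ℂ) • L) ∈ unitary (H →L[ℂ] H) :=
      exp_imag_unitary hLn z hz
    have hu' : NormedSpace.exp ((-z) • (n : ℂ) • L) ∈ unitary (H →L[ℂ] H) :=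
      exp_imag_unitary hLn (-z) (by simp [hz])
    have := ((((h.unitary_mul hu).mul_unitary hu').mul_contr (hKp k)
      (norm_pow_le_one' hK1 k))).contr_mul (hKp (n + m)) (norm_pow_le_one' hK1 _)
    convert this using 1
    have e : NormedSpace.exp ((1 - z) • (n : ℂ) • L) * K ^ (n + k)
        = B ^ n * NormedSpace.exp ((-z) • (n : ℂ) • L) * K ^ k := by
      rw [sub_eq_add_neg, exp_add_smul, one_smul, pow_add, ← hBn' n]
      have := (hcz n ((-z) * n)).eq
      rw [← smul_smul] at this
      simp only [mul_assoc]
      congr 1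
      rw [← mul_assoc, ← mul_assoc, this]
    rw [mul_assoc _ (NormedSpace.exp ((1 - z) • (n : ℂ) • L)), e]
    simp only [mul_assoc]
  · intro z hz
    have hu : NormedSpace.exp ((z - 1) • (n : ℂ) • L) ∈ unitary (H →L[ℂ] H) :=
      exp_imag_unitary hLn (z - 1) (by simp [hz])
    have hu' : NormedSpace.exp ((1 - z) • (n : ℂ) • L) ∈ unitary (H →L[ℂ] H) :=
      exp_imag_unitary hLn (1 - z) (by simp [hz])
    have := ((((h'.unitary_mul hu).mul_unitary hu').mul_contr (hKp (n + k))
      (norm_pow_le_one' hK1 _))).contr_mul (hKp m) (norm_pow_le_one' hK1 _)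
    convert this using 1
    have e : K ^ (n + m) * NormedSpace.exp (z • (n : ℂ) • L)
        = K ^ m * NormedSpace.exp ((z - 1) • (n : ℂ) • L) * B ^ n := by
      have h3 : NormedSpace.exp (z • (n : ℂ) • L) = NormedSpace.exp ((z - 1) • (n : ℂ) • L) *
          NormedSpace.exp ((n : ℂ) • L) := by
        conv_lhs => rw [← sub_add_cancel z 1, exp_add_smul, one_smul]
      rw [h3, add_comm n m, pow_add, ← hBn n]
      have := (hcz n ((z - 1) * n)).eq
      rw [← smul_smul] at this
      simp only [mul_assoc]
      congr 1
      rw [← mul_assoc, this, mul_assoc]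
    rw [e]
    simp only [mul_assoc]
  · have : ((k : ℂ) / n) = (((k : ℝ) / n : ℝ) : ℂ) := by push_cast; rfl
    rw [this, Complex.ofReal_re]; positivity
  · have : ((k : ℂ) / n) = (((k : ℝ) / n : ℝ) : ℂ) := by push_cast; rfl
    rw [this, Complex.ofReal_re]
    apply div_le_one_of_le₀ _ (by positivity)
    rw [hn]; push_cast; linarith [(Nat.cast_nonneg m : (0 : ℝ) ≤ m)]

theorem SB_unmix {A B : H →L[ℂ] H} (hA : IsSelfAdjoint A) (hB : IsSelfAdjoint B)
    (k m : ℕ) {M : ℝ} (hM : 0 ≤ M) (h : SB p (A * B ^ (k + m)) M) :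
    SB p (B ^ k * A * B ^ m) M := by
  have h' : SB p (B ^ (k + m) * A) M := by
    have := h.adj
    simpa [hA.star_eq, (hB.pow (k + m)).star_eq] using this
  rcases Nat.eq_zero_or_pos k with rfl | hk
  · simpa using h
  rcases Nat.eq_zero_or_pos m with rfl | hm
  · simpa using h'
  choose! L K h1 h2 h3 h4 h5 h6 using fun (ε : ℝ) (hε : 0 < ε) => exists_reg hB hε
  have hl : ∀ j : ℕ, ∀ ε : ℝ, 0 < ε → ‖K ε ^ (2 * j) * B - B‖ ≤ j * ε := by
    intro j ε hε
    induction j with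
    | zero => simp
    | succ j ih =>
      have : K ε ^ (2 * (j + 1)) * B - B
          = K ε ^ (2 * j) * (K ε * K ε * B - B) + (K ε ^ (2 * j) * B - B) := by
        rw [mul_sub, show 2 * (j + 1) = 2 * j + 1 + 1 by ring, pow_succ, pow_succ]
        simp only [mul_assoc]; abel
      rw [this]
      refine (norm_add_le _ _).trans ?_
      have : ‖K ε ^ (2 * j) * (K ε * K ε * B - B)‖ ≤ 1 * ε :=
        (norm_mul_le _ _).trans (mul_le_mul (norm_pow_le_one' (h3 ε hε) _) (h6 ε hε)
          (norm_nonneg _) zero_le_one)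
      push_cast
      linarith
  have ht : ∀ j : ℕ, Filter.Tendsto (fun ε => K ε ^ (2 * j) * B) (nhdsWithin 0 (Set.Ioi 0))
      (nhds B) := by
    intro j
    rw [tendsto_iff_norm_sub_tendsto_zero]
    have hz : Filter.Tendsto (fun ε : ℝ => j * ε) (nhdsWithin 0 (Set.Ioi 0)) (nhds 0) := by
      have : Filter.Tendsto (fun ε : ℝ => j * ε) (nhds 0) (nhds (j * 0)) :=
        (continuous_const.mul continuous_id).tendsto 0
      rw [mul_zero] at this
      exact this.mono_left nhdsWithin_le_nhds
    refine squeeze_zero' (Filter.Eventually.of_forall fun _ => norm_nonneg _) ?_ hz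
    filter_upwards [self_mem_nhdsWithin] with ε hε using hl j ε hε
  have hl1 : ∀ j i : ℕ, 0 < i → Filter.Tendsto (fun ε => K ε ^ (2 * j) * B ^ i)
      (nhdsWithin 0 (Set.Ioi 0)) (nhds (B ^ i)) := by
    intro j i hi
    obtain ⟨i, rfl⟩ : ∃ i', i = i' + 1 := ⟨i - 1, by omega⟩
    simp only [pow_succ', ← mul_assoc]
    exact (ht j).mul_const _
  have hl2 : Filter.Tendsto (fun ε => B ^ m * K ε ^ (2 * k))
      (nhdsWithin 0 (Set.Ioi 0)) (nhds (B ^ m)) := by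
    refine (hl1 k m hm).congr' ?_
    filter_upwards [self_mem_nhdsWithin] with ε hε
    have hcB : Commute (K ε) B := by
      rw [← h5 ε hε]; exact (Commute.refl _).mul_right (h4 ε hε).exp_right
    exact (hcB.pow_pow _ _).eq
  have hfin := (((hl1 m k hk).mul_const A).mul hl2)
  refine SB.of_tendsto hfin ?_
  filter_upwards [self_mem_nhdsWithin] with ε hε
  have := SB_reg (h1 ε hε) (h2 ε hε) (h3 ε hε) (h4 ε hε) (h5 ε hε) hk hM h h'
  simpa only [mul_assoc] using this

theorem SB_adIter {A B : H →L[ℂ] H} (hA : IsSelfAdjoint A) (hB : IsSelfAdjoint B) {M : ℝ}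
    (hM : 0 ≤ M) (n : ℕ) : ∀ k m : ℕ, SB p (A * B ^ (n + (k + m))) M →
    SB p (adIter B n (B ^ k * A * B ^ m)) (2 ^ n * M) := by
  induction n with
  | zero =>
    intro k m h
    simpa [adIter] using SB_unmix hA hB k m hM (by simpa using h)
  | succ n ih =>
    intro k m h
    have i1 := ih (k + 1) m (by convert h using 3; ring)
    have i2 := ih k (m + 1) (by convert h using 3; ring)
    have hsub : ∀ (j : ℕ) (S T : H →L[ℂ] H), adIter B j (S - T) = adIter B j S - adIter B j T := by
      intro j
      induction j with
      | zero => intro S T; rfl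
      | succ j ihj =>
        intro S T
        have : ∀ R, adIter B (j + 1) R = adIter B j (B * R - R * B) := fun R => rfl
        rw [this, this, this, ← ihj]
        congr 1
        rw [mul_sub, sub_mul]; abel
    have e : adIter B (n + 1) (B ^ k * A * B ^ m)
        = adIter B n (B ^ (k + 1) * A * B ^ m) - adIter B n (B ^ k * A * B ^ (m + 1)) := by
      rw [← hsub]
      change adIter B n (B * (B ^ k * A * B ^ m) - B ^ k * A * B ^ m * B) = _
      congr 1
      rw [pow_succ', pow_succ]
      simp only [mul_assoc]
    rw [e]
    refine (i1.sub i2).mono (le_of_eq ?_)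
    rw [pow_succ]; ring

theorem compact_of_small {T : H →L[ℂ] H}
    (h : ∀ η : ℝ, 0 < η → ∃ V : Submodule ℂ H, FiniteDimensional ℂ V ∧
      ∀ x ∈ Vᗮ, ‖T x‖ ≤ η * ‖x‖) : IsCompactOperator T := by
  have hcl : IsClosed {f : H →L[ℂ] H | IsCompactOperator f} :=
    isClosed_setOfPred_isCompactOperator
  change T ∈ {f : H →L[ℂ] H | IsCompactOperator f}
  rw [← hcl.closure_eq, Metric.mem_closure_iff]
  intro η hη
  obtain ⟨V, hV, hx⟩ := h (η / 2) (by positivity)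
  refine ⟨T * V.starProjection, ?_, ?_⟩
  · have h1 : IsCompactOperator (id : V → V) :=
      (isCompactOperator_id_iff_finiteDimensional (𝕜 := ℂ)).2 hV
    have h2 := (h1.clm_comp (T ∘L V.subtypeL)).comp_clm V.orthogonalProjectionOnto
    exact h2
  · rw [dist_eq_norm]
    refine lt_of_le_of_lt (ContinuousLinearMap.opNorm_le_bound _ (by positivity) ?_)
      (half_lt_self hη)
    intro x
    have e : (T - T * V.starProjection) x = T (x - V.starProjection x) := by
      simp
    rw [e]
    refine (hx _ (Submodule.sub_starProjection_mem_orthogonal x)).trans ?_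
    gcongr
    have e2 : x - V.starProjection x = Vᗮ.starProjection x := by
      rw [Submodule.starProjection_orthogonal']; simp
    rw [e2]
    exact Submodule.norm_starProjection_apply_le _ _

theorem exists_eigenbasis {S : H →L[ℂ] H} (hS : IsCompactOperator S) (hs : IsSelfAdjoint S) :
    ∃ (ι : Type u) (b : HilbertBasis ι ℂ H) (μ : ι → ℂ), ∀ i, S (b i) = μ i • b i := by
  have hsym : (S : H →ₗ[ℂ] H).IsSymmetric := hs.isSymmetric
  have hbot := ContinuousLinearMap.orthogonalComplement_iSup_eigenspaces_eq_bot hS hsym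
  choose w b hb using fun μ : ℂ => exists_hilbertBasis ℂ
    (Module.End.eigenspace (S : Module.End ℂ H) μ)
  have horth := hsym.orthogonalFamily_eigenspaces.orthonormal_sigma_orthonormal
    (α := fun μ => w μ) (v_family := fun μ => b μ) (fun μ => (b μ).orthonormal)
  refine ⟨Σ μ : ℂ, w μ, HilbertBasis.mkOfOrthogonalEqBot horth ?_, fun i => i.1, ?_⟩
  · rw [Submodule.eq_bot_iff]
    intro x hx
    have hx' : x ∈ (⨆ μ, Module.End.eigenspace (S : Module.End ℂ H) μ)ᗮ := by
      rw [← Submodule.iInf_orthogonal, Submodule.mem_iInf]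
      intro μ
      have h0 : (Module.End.eigenspace (S : Module.End ℂ H) μ).orthogonalProjectionOnto x = 0 := by
        apply (b μ).repr.injective
        ext i
        rw [HilbertBasis.repr_apply_apply, map_zero]
        rw [Submodule.inner_orthogonalProjectionOnto_eq_of_mem_left]
        exact (Submodule.mem_orthogonal _ _).1 hx _ (Submodule.subset_span ⟨⟨μ, i⟩, rfl⟩)
      exact Submodule.orthogonalProjectionOnto_eq_zero_iff.1 h0
    rw [hbot] at hx'
    simpa using hx'
  · rintro ⟨μ, i⟩
    rw [HilbertBasis.coe_mkOfOrthogonalEqBot]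
    exact Module.End.mem_eigenspace_iff.1 (b μ i).2

theorem cfc_inner_mono {S : H →L[ℂ] H} {g h : ℝ → ℝ} (hg : Continuous g)
    (hh : Continuous h) (hle : ∀ x ∈ spectrum ℝ S, g x ≤ h x) (v : H) :
    (inner ℂ v (cfc g S v)).re ≤ (inner ℂ v (cfc h S v)).re := by
  have h1 := cfc_mono hle hg.continuousOn hh.continuousOn
  rw [ContinuousLinearMap.le_def] at h1
  have := h1.re_inner_nonneg_right v
  simp [inner_sub_right] at this
  linarith

theorem cfc_affine_inner {S : H →L[ℂ] H} (hs : IsSelfAdjoint S) {g : ℝ → ℝ} (hg : Continuous g)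
    (δ C : ℝ) (v : H) : (inner ℂ v (cfc (fun x => δ + C * g x) S v)).re =
      δ * ‖v‖ ^ 2 + C * (inner ℂ v (cfc g S v)).re := by
  have h1 : cfc (fun x => δ + C * g x) S = δ • (1 : H →L[ℂ] H) + C • cfc g S := by
    rw [cfc_add S (fun _ => δ) (fun x => C * g x) continuousOn_const
      (continuous_const.mul hg).continuousOn, cfc_const_mul C g S hg.continuousOn,
      cfc_const _ S hs, Algebra.algebraMap_eq_smul_one]
  have h2 : (δ • (1 : H →L[ℂ] H) + C • cfc g S) v = (δ : ℂ) • v + (C : ℂ) • cfc g S v := by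
    simp
  rw [h1, h2, inner_add_right, inner_smul_right, inner_smul_right, inner_self_eq_norm_sq_to_K]
  rw [Complex.add_re, Complex.re_ofReal_mul, Complex.re_ofReal_mul]
  norm_cast

theorem cfc_eigen_s8 {S : H →L[ℂ] H} (hs : IsSelfAdjoint S) {g : ℝ → ℝ} (hg : Continuous g)
    {v : H} {t : ℝ} (hv : S v = (t : ℂ) • v) : cfc g S v = ((g t : ℝ) : ℂ) • v := by
  have hcomp : IsCompact (spectrum ℝ S) := ContinuousFunctionalCalculus.isCompact_spectrum S
  set g' : ℝ → ℝ := fun x => g x - g t with hg'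
  have hg'c : Continuous g' := by fun_prop
  obtain ⟨R, hR⟩ := hcomp.exists_bound_of_continuousOn (f := fun x => g' x * g' x)
    (by fun_prop)
  have e1 : cfc g' S = cfc g S - ((g t : ℝ) : ℂ) • (1 : H →L[ℂ] H) := by
    rw [hg', cfc_sub g (fun _ => g t) S hg.continuousOn continuousOn_const, cfc_const _ S hs,
      Algebra.algebraMap_eq_smul_one]
    rfl
  have sq : ∀ (f : ℝ → ℝ), Continuous f →
      (inner ℂ v (cfc (fun x => f x * f x) S v)).re = ‖cfc f S v‖ ^ 2 := by
    intro f hf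
    have hsa : IsSelfAdjoint (cfc f S) := cfc_predicate _ S
    rw [cfc_mul f f S hf.continuousOn hf.continuousOn, mul_apply_eq_comp]
    have : inner ℂ v (cfc f S (cfc f S v)) = inner ℂ (cfc f S v) (cfc f S v) := by
      rw [← ContinuousLinearMap.adjoint_inner_left, ← ContinuousLinearMap.star_eq_adjoint,
        hsa.star_eq]
    rw [this, inner_self_eq_norm_sq_to_K]
    norm_cast
  have e2 : cfc (fun x : ℝ => x - t) S v = 0 := by
    rw [cfc_sub (fun x : ℝ => x) (fun _ => t) S continuousOn_id continuousOn_const,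
      cfc_const _ S hs, cfc_id' ℝ S, Algebra.algebraMap_eq_smul_one]
    simp [hv]
  have key : ∀ δ : ℝ, 0 < δ → ‖cfc g' S v‖ ^ 2 ≤ δ * ‖v‖ ^ 2 := by
    intro δ hδ
    have hcont : Filter.Tendsto (fun x => g' x * g' x) (nhds t) (nhds 0) := by
      have : Continuous (fun x => g' x * g' x) := by fun_prop
      simpa [hg'] using this.tendsto t
    obtain ⟨ρ, hρ, hball⟩ := Metric.eventually_nhds_iff.1 (hcont.eventually (gt_mem_nhds hδ))
    have hmono := cfc_inner_mono (S := S) (g := fun x => g' x * g' x)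
      (h := fun x => δ + |R| / ρ ^ 2 * ((x - t) * (x - t))) (by fun_prop) (by fun_prop) ?_ v
    · rw [sq g' hg'c] at hmono
      rw [cfc_affine_inner hs (g := fun x => (x - t) * (x - t)) (by fun_prop),
        sq (fun x => x - t) (by fun_prop), e2] at hmono
      simpa using hmono
    · intro x hx
      by_cases hd : dist x t < ρ
      · have := hball hd
        have h2 : 0 ≤ |R| / ρ ^ 2 * ((x - t) * (x - t)) :=
          mul_nonneg (by positivity) (mul_self_nonneg _)
        linarith
      · rw [not_lt, Real.dist_eq] at hd
        have h1 := hR x hx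
        rw [Real.norm_eq_abs] at h1
        have h2 : |R| ≤ |R| / ρ ^ 2 * ((x - t) * (x - t)) := by
          rw [div_mul_eq_mul_div, le_div_iff₀ (by positivity)]
          apply mul_le_mul_of_nonneg_left _ (abs_nonneg _)
          rw [← abs_mul_abs_self (x - t), ← pow_two]
          exact pow_le_pow_left₀ hρ.le hd 2
        linarith [le_abs_self (g' x * g' x), le_abs_self R]
  have h0 : cfc g' S v = 0 := by
    by_contra hne
    have hpos : 0 < ‖cfc g' S v‖ ^ 2 := by positivity
    have := key (‖cfc g' S v‖ ^ 2 / (2 * (‖v‖ ^ 2 + 1))) (by positivity)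
    rw [div_mul_eq_mul_div, le_div_iff₀ (by positivity)] at this
    nlinarith [sq_nonneg ‖v‖, mul_nonneg hpos.le (sq_nonneg ‖v‖)]
  rw [e1] at h0
  simpa [sub_eq_zero] using h0

theorem orthonormal_option {ι : Type*} {e : ι → H} (he : Orthonormal ℂ e) {x : H} (hx : ‖x‖ = 1)
    (h : ∀ i, inner ℂ (e i) x = 0) : Orthonormal ℂ (fun o : Option ι => o.elim x e) := by
  refine ⟨?_, ?_⟩
  · rintro (_ | i)
    · exact hx
    · exact he.1 i
  · rintro (_ | i) (_ | j) hij
    · exact absurd rfl hij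
    · exact inner_eq_zero_symm.1 (h j)
    · exact h i
    · exact he.2 (fun h => hij (by rw [h]))

theorem compact_of_SB {T : H →L[ℂ] H} {M : ℝ} (hp : p ≠ ∞) (hT : SB p T M) :
    IsCompactOperator T := by
  have hq : 0 < p.toReal :=
    ENNReal.toReal_pos (zero_lt_one.trans_le (Fact.out : 1 ≤ p)).ne' hp
  by_contra hcon
  have hcon' := mt compact_of_small hcon
  push Not at hcon'
  obtain ⟨η, hη, hV⟩ := hcon'
  have build : ∀ N : ℕ, ∃ (ι : Type u) (_ : Fintype ι) (e f : ι → H), Fintype.card ι = N ∧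
      Orthonormal ℂ e ∧ Orthonormal ℂ f ∧ ∀ i, η ≤ ‖inner ℂ (f i) (T (e i))‖ := by
    intro N
    induction N with
    | zero =>
      refine ⟨PEmpty, inferInstance, PEmpty.elim, PEmpty.elim, rfl, ?_, ?_, fun i => i.elim⟩
      · exact ⟨fun i => i.elim, fun i => i.elim⟩
      · exact ⟨fun i => i.elim, fun i => i.elim⟩
    | succ N ih =>
      obtain ⟨ι, _, e, f, hcard, he, hf, hb⟩ := ih
      obtain ⟨x, hx, hTx⟩ := hV (Submodule.span ℂ (Set.range e ∪ Set.range (fun i => star T (f i))))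
        (FiniteDimensional.span_of_finite ℂ ((Set.finite_range _).union (Set.finite_range _)))
      have hx0 : x ≠ 0 := by
        rintro rfl
        simp at hTx
      have hnx : 0 < ‖x‖ := norm_pos_iff.2 hx0
      have hTx0 : 0 < ‖T x‖ := lt_of_le_of_lt (by positivity) hTx
      have h1 : ∀ i, inner ℂ (e i) x = 0 := fun i =>
        (Submodule.mem_orthogonal _ _).1 hx _ (Submodule.subset_span (Or.inl ⟨i, rfl⟩))
      have h2 : ∀ i, inner ℂ (f i) (T x) = 0 := fun i => by
        have := (Submodule.mem_orthogonal _ _).1 hx _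
          (Submodule.subset_span (Or.inr ⟨i, rfl⟩))
        rwa [ContinuousLinearMap.star_eq_adjoint, ContinuousLinearMap.adjoint_inner_left] at this
      refine ⟨Option ι, inferInstance, fun o => o.elim ((‖x‖⁻¹ : ℂ) • x) e,
        fun o => o.elim ((‖T x‖⁻¹ : ℂ) • T x) f, by simp [hcard],
        orthonormal_option he ?_ ?_, orthonormal_option hf ?_ ?_, ?_⟩
      · rw [norm_smul]; simp [hnx.ne']
      · intro i; rw [inner_smul_right, h1, mul_zero]
      · rw [norm_smul]; simp [hTx0.ne']
      · intro i; rw [inner_smul_right, h2, mul_zero]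
      · rintro (_ | i)
        · simp only [Option.elim_none, map_smul, inner_smul_left, inner_smul_right,
            inner_self_eq_norm_sq_to_K, norm_mul]
          simp only [map_inv₀, Complex.conj_ofReal, norm_inv, Complex.norm_real, norm_norm,
            norm_pow, RCLike.norm_ofReal, abs_norm, Complex.coe_algebraMap]
          rw [inv_mul_eq_div, inv_mul_eq_div, div_div, le_div_iff₀ (by positivity)]
          nlinarith
        · exact hb i
  obtain ⟨N, hN⟩ := exists_nat_gt (|M| ^ p.toReal / η ^ p.toReal)
  obtain ⟨ι, _, e, f, hcard, he, hf, hb⟩ := build N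
  have h1 := hT ι e f he hf
  rw [PiLp.norm_eq_sum hq] at h1
  have h2 : (∑ i : ι, ‖(entries p T e f) i‖ ^ p.toReal) ≤ |M| ^ p.toReal := by
    have h3 : 0 ≤ ∑ i : ι, ‖(entries p T e f) i‖ ^ p.toReal :=
      Finset.sum_nonneg fun i _ => by positivity
    have := Real.rpow_le_rpow (by positivity) (h1.trans (le_abs_self M)) hq.le
    rwa [← Real.rpow_mul h3, one_div_mul_cancel hq.ne', Real.rpow_one] at this
  have h3 : (N : ℝ) * η ^ p.toReal ≤ ∑ i : ι, ‖(entries p T e f) i‖ ^ p.toReal := by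
    rw [← hcard, ← nsmul_eq_mul, ← Finset.card_univ]
    apply Finset.card_nsmul_le_sum
    intro i _
    exact Real.rpow_le_rpow hη.le (hb i) hq.le
  rw [div_lt_iff₀ (by positivity)] at hN
  linarith

theorem compact_of_trace_s8 {T : H →L[ℂ] H} {q : ℝ} (hq : 0 < q)
    (h : traceE (absPowE T q) ≠ ⊤) : IsCompactOperator T := by
  apply compact_of_small
  intro η hη
  have hq2 : 0 < q / 2 := by positivity
  have hcomp : IsCompact (spectrum ℝ (star T * T)) :=
    ContinuousFunctionalCalculus.isCompact_spectrum _
  have hsa : IsSelfAdjoint (star T * T) := IsSelfAdjoint.star_mul_self T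
  obtain ⟨R, hR⟩ := hcomp.exists_bound_of_continuousOn (f := fun x => x) continuousOn_id
  set δ : ℝ := η ^ 2 / 2 with hδ
  have hδ0 : 0 < δ := by positivity
  set C : ℝ := (|R| + 1) / δ ^ (q / 2) with hC
  have hC0 : 0 < C := by positivity
  have hcont : Continuous (fun x : ℝ => x ^ (q / 2)) := Real.continuous_rpow_const hq2.le
  have hε : ENNReal.ofReal (δ / C) ≠ 0 := by
    rw [Ne, ENNReal.ofReal_eq_zero, not_le]; positivity
  -- almost maximal finite orthonormal family
  obtain ⟨s, hs, hsum⟩ : ∃ s : Finset H, Orthonormal ℂ (fun v : s => (v : H)) ∧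
      traceE (absPowE T q) ≤
        ∑ v ∈ s, ENNReal.ofReal (Complex.re (inner (𝕜 := ℂ) v (absPowE T q v)))
          + ENNReal.ofReal (δ / C) := by
    by_contra hcon
    push Not at hcon
    have h0 : traceE (absPowE T q) ≠ 0 := by
      have := hcon ∅ 
        ⟨fun i => absurd i.2 (Finset.notMem_empty _), fun i => absurd i.2 (Finset.notMem_empty _)⟩
      exact (pos_of_gt this).ne'
    have h1 : traceE (absPowE T q) ≤ traceE (absPowE T q) - ENNReal.ofReal (δ / C) := by
      conv_lhs => rw [traceE]
      refine iSup₂_le fun s hs => ?_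
      exact ENNReal.le_sub_of_add_le_right ENNReal.ofReal_ne_top (hcon s hs).le
    exact absurd h1 (not_le.2 (ENNReal.sub_lt_self h h0 hε))
  refine ⟨Submodule.span ℂ (s : Set H), FiniteDimensional.span_finset ℂ s, ?_⟩
  have unit : ∀ u ∈ (Submodule.span ℂ (s : Set H))ᗮ, ‖u‖ = 1 → ‖T u‖ ≤ η := by
    intro u hu hu1
    have hus : ∀ v ∈ s, inner ℂ v u = 0 := fun v hv =>
      (Submodule.mem_orthogonal _ _).1 hu _ (Submodule.subset_span hv)
    have hu_not : u ∉ s := by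
      intro hmem
      have := hus u hmem
      rw [inner_self_eq_zero] at this
      rw [this] at hu1
      simp at hu1
    have hins : Orthonormal ℂ (fun v : (insert u s : Finset H) => (v : H)) := by
      refine ⟨?_, ?_⟩
      · rintro ⟨v, hv⟩
        rcases Finset.mem_insert.1 hv with rfl | hv
        · exact hu1
        · exact hs.1 ⟨v, hv⟩
      · rintro ⟨v, hv⟩ ⟨w, hw⟩ hvw
        have hvw' : v ≠ w := fun h => hvw (Subtype.ext h)
        change inner ℂ v w = 0
        rcases Finset.mem_insert.1 hv with hv1 | hv1 <;>
          rcases Finset.mem_insert.1 hw with hw1 | hw1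
        · exact absurd (hv1.trans hw1.symm) hvw'
        · rw [hv1]; exact inner_eq_zero_symm.1 (hus w hw1)
        · rw [hw1]; exact hus v hv1
        · exact hs.2 (i := ⟨v, hv1⟩) (j := ⟨w, hw1⟩) (fun h => hvw' (congrArg Subtype.val h))
    have h1 : ∑ v ∈ insert u s, ENNReal.ofReal (Complex.re (inner (𝕜 := ℂ) v (absPowE T q v))) ≤
        traceE (absPowE T q) := by
      rw [traceE]
      exact le_iSup₂ (f := fun (s : Finset H) (_ : Orthonormal ℂ (fun v : s => (v : H))) =>
        ∑ v ∈ s, ENNReal.ofReal (Complex.re (inner (𝕜 := ℂ) v (absPowE T q v))))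
        (insert u s) hins
    rw [Finset.sum_insert hu_not] at h1
    have h2 := h1.trans hsum
    have hfin : ∑ v ∈ s, ENNReal.ofReal (Complex.re (inner (𝕜 := ℂ) v (absPowE T q v))) ≠ ⊤ := by
      rw [ENNReal.sum_ne_top]
      exact fun _ _ => ENNReal.ofReal_ne_top
    rw [add_comm, ENNReal.add_le_add_iff_left hfin,
      ENNReal.ofReal_le_ofReal_iff (by positivity)] at h2
    have hmono := cfc_inner_mono (S := star T * T) (g := fun x => x)
      (h := fun x => δ + C * x ^ (q / 2)) continuous_id (by fun_prop) ?_ u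
    · rw [cfc_id' ℝ (star T * T), cfc_affine_inner hsa hcont, hu1] at hmono
      change (inner ℂ u ((star T * T) u)).re ≤
        δ * 1 ^ 2 + C * (inner ℂ u (absPowE T q u)).re at hmono
      have e1 : (inner ℂ u ((star T * T) u)).re = ‖T u‖ ^ 2 := by
        rw [mul_apply_eq_comp, ContinuousLinearMap.star_eq_adjoint,
          ContinuousLinearMap.adjoint_inner_right, inner_self_eq_norm_sq_to_K]
        norm_cast
      rw [e1] at hmono
      have h3 : C * (inner ℂ u (absPowE T q u)).re ≤ δ := by
        have := mul_le_mul_of_nonneg_left h2 hC0.le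
        rwa [mul_div_cancel₀ _ hC0.ne'] at this
      have h4 : ‖T u‖ ^ 2 ≤ η ^ 2 := by
        have : δ + δ = η ^ 2 := by rw [hδ]; ring
        linarith
      exact le_of_sq_le_sq h4 hη.le
    · intro x hx
      have hx0 : 0 ≤ x := spectrum_nonneg_of_nonneg (star_mul_self_nonneg T) hx
      rcases le_total x δ with h | h
      · have : 0 ≤ C * x ^ (q / 2) := by positivity
        change x ≤ δ + C * x ^ (q / 2)
        linarith
      · have h1 : x ≤ |R| := by
          have := hR x hx
          rw [Real.norm_eq_abs] at this
          exact (le_abs_self x).trans (this.trans (le_abs_self R))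
        have h2 : |R| + 1 ≤ C * x ^ (q / 2) := by
          rw [hC, div_mul_eq_mul_div, le_div_iff₀ (by positivity)]
          gcongr
        change x ≤ δ + C * x ^ (q / 2)
        linarith
  intro x hx
  by_cases hx0 : x = 0
  · simp [hx0]
  have hnx : 0 < ‖x‖ := norm_pos_iff.2 hx0
  have := unit ((‖x‖⁻¹ : ℂ) • x) (Submodule.smul_mem _ _ hx) (by rw [norm_smul]; simp [hnx.ne'])
  rw [map_smul, norm_smul] at this
  simp only [norm_inv, Complex.norm_real, norm_norm] at this
  rwa [inv_mul_le_iff₀ hnx, mul_comm] at this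

theorem exists_singular_basis {T : H →L[ℂ] H} (hT : IsCompactOperator T) :
    ∃ (ι : Type u) (b : HilbertBasis ι ℂ H),
      (∀ i j, i ≠ j → inner ℂ (T (b i)) (T (b j)) = 0) ∧
      ∀ q : ℝ, 0 < q → ∀ i, absPowE T q (b i) = ((‖T (b i)‖ ^ q : ℝ) : ℂ) • b i := by
  have hsa : IsSelfAdjoint (star T * T) := IsSelfAdjoint.star_mul_self T
  obtain ⟨ι, b, μ, hb⟩ := exists_eigenbasis (S := star T * T) (hT.clm_comp (star T)) hsa
  have hin : ∀ i j, inner ℂ (T (b i)) (T (b j)) = μ j * inner ℂ (b i) (b j) := by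
    intro i j
    rw [← inner_smul_right, ← hb j, mul_apply_eq_comp, ContinuousLinearMap.star_eq_adjoint,
      ContinuousLinearMap.adjoint_inner_right]
  have hμ : ∀ i, μ i = ((‖T (b i)‖ ^ 2 : ℝ) : ℂ) := by
    intro i
    have := hin i i
    rw [inner_self_eq_norm_sq_to_K, inner_self_eq_norm_sq_to_K, b.orthonormal.1 i] at this
    simpa using this.symm
  refine ⟨ι, b, ?_, ?_⟩
  · intro i j hij
    rw [hin, b.orthonormal.2 hij, mul_zero]
  · intro q hq i
    have hcont : Continuous (fun x : ℝ => x ^ (q / 2)) :=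
      Real.continuous_rpow_const (by positivity)
    rw [absPowE, cfc_eigen_s8 hsa hcont (t := ‖T (b i)‖ ^ 2) (by rw [hb, hμ])]
    congr 2
    rw [← Real.rpow_natCast, ← Real.rpow_mul (norm_nonneg _)]
    congr 1
    push_cast
    ring

theorem trace_le_tsum {ι : Type u} (b : HilbertBasis ι ℂ H) {P : H →L[ℂ] H}
    (hP : IsSelfAdjoint P) {l : ι → ℝ} (hl : ∀ i, 0 ≤ l i)
    (hb : ∀ i, P (b i) = (l i : ℂ) • b i) :
    traceE P ≤ ∑' i, ENNReal.ofReal (l i) := by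
  rw [traceE]
  refine iSup₂_le fun s hs => ?_
  have h1 : ∀ v : H, ENNReal.ofReal (Complex.re (inner (𝕜 := ℂ) v (P v))) =
      ∑' i, ENNReal.ofReal (l i * ‖inner ℂ v (b i)‖ ^ 2) := by
    intro v
    have h2 := b.hasSum_inner_mul_inner v (P v)
    have h3 : ∀ i, inner ℂ v (b i) * inner ℂ (b i) (P v) =
        ((l i * ‖inner ℂ v (b i)‖ ^ 2 : ℝ) : ℂ) := by
      intro i
      have h4 : inner ℂ (b i) (P v) = (l i : ℂ) * inner ℂ (b i) v := by
        rw [← ContinuousLinearMap.adjoint_inner_left, ← ContinuousLinearMap.star_eq_adjoint,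
          hP.star_eq, hb, inner_smul_left, Complex.conj_ofReal]
      rw [h4, ← inner_conj_symm (b i) v]
      have := Complex.mul_conj' (inner ℂ v (b i))
      push_cast
      rw [← this]
      ring
    simp_rw [h3] at h2
    have h5 := Complex.hasSum_re h2
    simp only [Complex.ofReal_re] at h5
    rw [← h5.tsum_eq, ENNReal.ofReal_tsum_of_nonneg _ h5.summable]
    intro i
    have := hl i
    positivity
  simp_rw [h1]
  rw [← Summable.tsum_finsetSum (fun _ _ => ENNReal.summable)]
  refine ENNReal.tsum_le_tsum fun i => ?_
  rw [← ENNReal.ofReal_sum_of_nonneg (fun v _ => by have := hl i; positivity)]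
  apply ENNReal.ofReal_le_ofReal
  rw [← Finset.mul_sum]
  have h6 : ∑ v ∈ s, ‖inner ℂ v (b i)‖ ^ 2 ≤ 1 := by
    have := hs.sum_inner_products_le (x := b i) (s := Finset.univ)
    rw [b.orthonormal.1 i, one_pow] at this
    rwa [← Finset.sum_coe_sort s (fun v => ‖inner ℂ v (b i)‖ ^ 2)]
  exact mul_le_of_le_one_right (hl i) h6

theorem sum_le_trace {ι : Type u} (b : HilbertBasis ι ℂ H) {P : H →L[ℂ] H}
    {l : ι → ℝ} (hb : ∀ i, P (b i) = (l i : ℂ) • b i) (F : Finset ι) :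
    ∑ i ∈ F, ENNReal.ofReal (l i) ≤ traceE P := by
  have hinj : Function.Injective (b : ι → H) := b.orthonormal.linearIndependent.injective
  have hs : Orthonormal ℂ (fun v : (F.image b : Finset H) => (v : H)) := by
    have := b.orthonormal.toSubtypeRange
    refine this.comp (fun v : (F.image b : Finset H) => (⟨v.1, ?_⟩ : Set.range b)) ?_
    · obtain ⟨i, -, hi⟩ := Finset.mem_image.1 v.2
      exact ⟨i, hi⟩
    · intro v w hvw
      exact Subtype.ext (congrArg (fun z : Set.range b => (z : H)) hvw)
  have h1 : ∑ i ∈ F, ENNReal.ofReal (l i) =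
      ∑ v ∈ F.image b, ENNReal.ofReal (Complex.re (inner (𝕜 := ℂ) v (P v))) := by
    rw [Finset.sum_image (fun _ _ _ _ h => hinj h)]
    refine Finset.sum_congr rfl fun i _ => ?_
    rw [hb, inner_smul_right, inner_self_eq_norm_sq_to_K, b.orthonormal.1 i]
    simp
  rw [h1, traceE]
  exact le_iSup₂ (f := fun (s : Finset H) (_ : Orthonormal ℂ (fun v : s => (v : H))) =>
    ∑ v ∈ s, ENNReal.ofReal (Complex.re (inner (𝕜 := ℂ) v (P v)))) (F.image b) hs

theorem jensen_sub {ι : Type*} (F : Finset ι) (w z : ι → ℝ) (hw : ∀ i, 0 ≤ w i)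
    (hz : ∀ i, 0 ≤ z i) (h1 : ∑ i ∈ F, w i ≤ 1) {q : ℝ} (hq : 1 ≤ q) :
    (∑ i ∈ F, w i * z i) ^ q ≤ ∑ i ∈ F, w i * z i ^ q := by
  have := Real.rpow_arith_mean_le_arith_mean_rpow (Finset.insertNone F)
    (fun o => o.elim (1 - ∑ i ∈ F, w i) w) (fun o => o.elim 0 z) ?_ ?_ ?_ hq
  · rw [Finset.sum_insertNone, Finset.sum_insertNone] at this
    simpa [Real.zero_rpow (by linarith : q ≠ 0)] using this
  · rintro (_ | i) _
    · simpa using h1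
    · exact hw i
  · rw [Finset.sum_insertNone]
    simp
  · rintro (_ | i) _
    · simp
    · exact hz i

theorem bessel_sub {ι : Type*} (g : ι → H) (h0 : ∀ i j, i ≠ j → inner ℂ (g i) (g j) = 0)
    (h1 : ∀ i, g i ≠ 0 → ‖g i‖ = 1) (F : Finset ι) (x : H) :
    ∑ i ∈ F, ‖inner ℂ (g i) x‖ ^ 2 ≤ ‖x‖ ^ 2 := by
  have ho : Orthonormal ℂ (fun i : {i // g i ≠ 0} => g i) :=
    ⟨fun i => h1 i i.2, fun i j hij => h0 i j (fun h => hij (Subtype.ext h))⟩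
  have h2 := ho.sum_inner_products_le (x := x) (s := F.subtype (fun i => g i ≠ 0))
  refine le_trans (le_of_eq ?_) h2
  rw [Finset.sum_subtype_eq_sum_filter (f := fun i => ‖inner ℂ (g i) x‖ ^ 2), Finset.sum_filter]
  refine Finset.sum_congr rfl fun i _ => ?_
  split_ifs with h
  · rfl
  · rw [not_not.1 h]; simp

/-- normalised images of a singular basis -/
def gvec {ι : Type*} (T : H →L[ℂ] H) (b : ι → H) (i : ι) : H := ((‖T (b i)‖⁻¹ : ℝ) : ℂ) • T (b i)

theorem gvec_smul {ι : Type*} (T : H →L[ℂ] H) (b : ι → H) (i : ι) :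
    T (b i) = (‖T (b i)‖ : ℂ) • gvec T b i := by
  rw [gvec, smul_smul]
  by_cases h : T (b i) = 0
  · simp [h]
  · have : (‖T (b i)‖ : ℂ) ≠ 0 := by simpa using h
    push_cast
    rw [mul_inv_cancel₀ this, one_smul]

theorem gvec_orth {ι : Type*} {T : H →L[ℂ] H} {b : ι → H}
    (h : ∀ i j, i ≠ j → inner ℂ (T (b i)) (T (b j)) = 0) (i j : ι) (hij : i ≠ j) :
    inner ℂ (gvec T b i) (gvec T b j) = 0 := by
  rw [gvec, gvec, inner_smul_left, inner_smul_right, h i j hij]; simp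

theorem gvec_norm {ι : Type*} {T : H →L[ℂ] H} {b : ι → H} {i : ι} (h : T (b i) ≠ 0) :
    ‖gvec T b i‖ = 1 := by
  rw [gvec, norm_smul]
  simp [h]

theorem gvec_norm_le {ι : Type*} (T : H →L[ℂ] H) (b : ι → H) (i : ι) :
    ‖gvec T b i‖ ^ 2 ≤ 1 := by
  by_cases h : T (b i) = 0
  · simp [gvec, h]
  · rw [gvec_norm h, one_pow]

theorem SB_finite {T : H →L[ℂ] H} {ι κ : Type*} [Fintype κ] {b : ι → H} (hb : Orthonormal ℂ b)
    (h : ∀ i j, i ≠ j → inner ℂ (T (b i)) (T (b j)) = 0) {e f : κ → H} (he : Orthonormal ℂ e)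
    (hf : Orthonormal ℂ f) (F : Finset ι) {q : ℝ} (hq : 1 ≤ q) :
    ∑ k, ‖∑ i ∈ F, inner ℂ (f k) (T (b i)) * inner ℂ (b i) (e k)‖ ^ q ≤
      ∑ i ∈ F, ‖T (b i)‖ ^ q := by
  set w : κ → ι → ℝ := fun k i => ‖inner ℂ (f k) (gvec T b i)‖ * ‖inner ℂ (b i) (e k)‖ with hw
  have hw0 : ∀ k i, 0 ≤ w k i := fun k i => by positivity
  have amgm : ∀ k i, w k i ≤ (‖inner ℂ (f k) (gvec T b i)‖ ^ 2 + ‖inner ℂ (b i) (e k)‖ ^ 2) / 2 := by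
    intro k i
    have := two_mul_le_add_sq ‖inner ℂ (f k) (gvec T b i)‖ ‖inner ℂ (b i) (e k)‖
    simp only [hw]
    linarith
  have hwi : ∀ k, ∑ i ∈ F, w k i ≤ 1 := by
    intro k
    refine (Finset.sum_le_sum fun i _ => amgm k i).trans ?_
    rw [← Finset.sum_div, Finset.sum_add_distrib]
    have h1 := bessel_sub (gvec T b) (gvec_orth h)
      (fun i hi => gvec_norm (fun h0 => hi (by simp [gvec, h0]))) F (f k)
    have h2 := hb.sum_inner_products_le (x := e k) (s := F)
    rw [hf.1 k] at h1
    rw [he.1 k] at h2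
    simp_rw [norm_inner_symm (f k)]
    linarith
  have hwk : ∀ i, ∑ k, w k i ≤ 1 := by
    intro i
    refine (Finset.sum_le_sum fun k _ => amgm k i).trans ?_
    rw [← Finset.sum_div, Finset.sum_add_distrib]
    have h1 := hf.sum_inner_products_le (x := gvec T b i) (s := Finset.univ)
    have h2 := he.sum_inner_products_le (x := b i) (s := Finset.univ)
    rw [hb.1 i] at h2
    have h3 := gvec_norm_le T b i
    simp_rw [norm_inner_symm (b i)]
    linarith
  calc ∑ k, ‖∑ i ∈ F, inner ℂ (f k) (T (b i)) * inner ℂ (b i) (e k)‖ ^ q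
      ≤ ∑ k, ∑ i ∈ F, w k i * ‖T (b i)‖ ^ q := by
        refine Finset.sum_le_sum fun k _ => ?_
        refine le_trans (Real.rpow_le_rpow (norm_nonneg _) ?_ (by linarith))
          (jensen_sub F (w k) (fun i => ‖T (b i)‖) (hw0 k) (fun i => norm_nonneg _) (hwi k) hq)
        refine (norm_sum_le _ _).trans (Finset.sum_le_sum fun i _ => le_of_eq ?_)
        conv_lhs => rw [gvec_smul T b i]
        rw [inner_smul_right, norm_mul, norm_mul, Complex.norm_real, norm_norm]
        simp only [hw]
        ring
    _ = ∑ i ∈ F, (∑ k, w k i) * ‖T (b i)‖ ^ q := by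
        rw [Finset.sum_comm]
        simp_rw [Finset.sum_mul]
    _ ≤ ∑ i ∈ F, ‖T (b i)‖ ^ q := by
        refine Finset.sum_le_sum fun i _ => ?_
        exact mul_le_of_le_one_left (by positivity) (hwk i)

theorem SB_of_schatten {T : H →L[ℂ] H} {M : ℝ} (hM : 0 ≤ M)
    (h : schattenE p T ≤ ENNReal.ofReal M) : SB p T M := by
  intro ι _ e f he hf
  by_cases hp : p = ∞
  · subst hp
    rw [schattenE, if_pos rfl] at h
    have hT : ‖T‖ ≤ M := by
      have : (‖T‖₊ : ℝ≥0∞) = ENNReal.ofReal ‖T‖ := by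
        rw [ofReal_norm_eq_enorm]; rfl
      rw [this, ENNReal.ofReal_le_ofReal_iff hM] at h
      exact h
    rw [PiLp.norm_eq_ciSup]
    refine Real.iSup_le (fun i => ?_) hM
    change ‖inner ℂ (f i) (T (e i))‖ ≤ M
    refine (norm_inner_le_norm _ _).trans ?_
    rw [hf.1 i, one_mul]
    refine (T.le_opNorm _).trans ?_
    rw [he.1 i, mul_one]
    exact hT
  have hp1 : (1 : ℝ≥0∞) ≤ p := Fact.out
  have hq1 : 1 ≤ p.toReal := by
    rw [← ENNReal.toReal_one]
    exact ENNReal.toReal_mono hp hp1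
  have hq : 0 < p.toReal := by linarith
  rw [schattenE, if_neg hp] at h
  have htr : traceE (absPowE T p.toReal) ≤ ENNReal.ofReal (M ^ p.toReal) := by
    have := ENNReal.rpow_le_rpow h hq.le
    rwa [← ENNReal.rpow_mul, one_div_mul_cancel hq.ne', ENNReal.rpow_one,
      ENNReal.ofReal_rpow_of_nonneg hM hq.le] at this
  have hT : IsCompactOperator T :=
    compact_of_trace_s8 hq (ne_top_of_le_ne_top ENNReal.ofReal_ne_top htr)
  obtain ⟨κ, b, hb1, hb2⟩ := exists_singular_basis hT
  have hF : ∀ F : Finset κ, ∑ i ∈ F, ‖T (b i)‖ ^ p.toReal ≤ M ^ p.toReal := by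
    intro F
    have := (sum_le_trace b (hb2 p.toReal hq) F).trans htr
    rwa [← ENNReal.ofReal_sum_of_nonneg (fun _ _ => by positivity),
      ENNReal.ofReal_le_ofReal_iff (by positivity)] at this
  have hlim : ∑ k, ‖inner ℂ (f k) (T (e k))‖ ^ p.toReal ≤ M ^ p.toReal := by
    have ht : Filter.Tendsto (fun F : Finset κ =>
        ∑ k, ‖∑ i ∈ F, inner ℂ (f k) (T (b i)) * inner ℂ (b i) (e k)‖ ^ p.toReal) Filter.atTop
        (nhds (∑ k, ‖inner ℂ (f k) (T (e k))‖ ^ p.toReal)) := by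
      refine tendsto_finset_sum _ fun k _ => ?_
      refine Filter.Tendsto.rpow_const (Filter.Tendsto.norm ?_) (Or.inr hq.le)
      have := b.hasSum_inner_mul_inner (star T (f k)) (e k)
      simp only [ContinuousLinearMap.star_eq_adjoint,
        ContinuousLinearMap.adjoint_inner_left] at this
      exact this
    exact le_of_tendsto ht (Filter.Eventually.of_forall fun F =>
      (SB_finite b.orthonormal hb1 he hf F hq1).trans (hF F))
  rw [PiLp.norm_eq_sum hq]
  have := Real.rpow_le_rpow (Finset.sum_nonneg fun k _ => by positivity) hlim
    (one_div_nonneg.2 hq.le)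
  rwa [← Real.rpow_mul hM, mul_one_div_cancel hq.ne', Real.rpow_one] at this

theorem schatten_of_SB {T : H →L[ℂ] H} {M : ℝ} (hM : 0 ≤ M) (h : SB p T M) :
    schattenE p T ≤ ENNReal.ofReal M := by
  by_cases hp : p = ∞
  · subst hp
    rw [schattenE, if_pos rfl]
    have hT : ‖T‖ ≤ M := by
      refine T.opNorm_le_bound hM fun x => ?_
      by_cases hTx : T x = 0
      · rw [hTx, norm_zero]; positivity
      have hx : x ≠ 0 := by rintro rfl; simp at hTx
      have hnx : 0 < ‖x‖ := norm_pos_iff.2 hx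
      have hnT : 0 < ‖T x‖ := norm_pos_iff.2 hTx
      have ho : ∀ y : H, y ≠ 0 →
          Orthonormal ℂ (fun _ : PUnit.{u + 1} => ((‖y‖⁻¹ : ℝ) : ℂ) • y) := by
        intro y hy
        refine ⟨fun i => ?_, fun i j hij => absurd rfl hij⟩
        rw [norm_smul]
        simp [hy]
      have h1 := h PUnit _ _ (ho x hx) (ho (T x) hTx)
      rw [PiLp.norm_eq_ciSup, ciSup_unique] at h1
      change ‖inner ℂ (((‖T x‖⁻¹ : ℝ) : ℂ) • T x) (T (((‖x‖⁻¹ : ℝ) : ℂ) • x))‖ ≤ M at h1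
      rw [map_smul, inner_smul_left, inner_smul_right, inner_self_eq_norm_sq_to_K, norm_mul,
        norm_mul] at h1
      simp only [Complex.conj_ofReal, Complex.norm_real, norm_inv, norm_norm, norm_pow,
        Complex.coe_algebraMap] at h1
      have e1 : ‖T x‖⁻¹ * (‖x‖⁻¹ * ‖T x‖ ^ 2) = ‖T x‖ / ‖x‖ := by
        field_simp
      rw [e1, div_le_iff₀ hnx] at h1
      exact h1
    have : (‖T‖₊ : ℝ≥0∞) = ENNReal.ofReal ‖T‖ := by
      rw [ofReal_norm_eq_enorm]; rfl
    rw [this]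
    exact ENNReal.ofReal_le_ofReal hT
  have hq : 0 < p.toReal :=
    ENNReal.toReal_pos (zero_lt_one.trans_le (Fact.out : 1 ≤ p)).ne' hp
  rw [schattenE, if_neg hp]
  obtain ⟨κ, b, hb1, hb2⟩ := exists_singular_basis (compact_of_SB hp h)
  have hsa : IsSelfAdjoint (absPowE T p.toReal) := cfc_predicate _ _
  have htr : traceE (absPowE T p.toReal) ≤ ENNReal.ofReal (M ^ p.toReal) := by
    refine (trace_le_tsum b hsa (fun i => by positivity) (hb2 p.toReal hq)).trans ?_
    rw [ENNReal.tsum_eq_iSup_sum]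
    refine iSup_le fun F => ?_
    rw [← ENNReal.ofReal_sum_of_nonneg (fun _ _ => by positivity)]
    apply ENNReal.ofReal_le_ofReal
    set G := F.filter (fun i => T (b i) ≠ 0) with hG
    have hsum : ∑ i ∈ F, ‖T (b i)‖ ^ p.toReal = ∑ i ∈ G, ‖T (b i)‖ ^ p.toReal := by
      rw [hG, Finset.sum_filter]
      refine Finset.sum_congr rfl fun i _ => ?_
      split_ifs with h0
      · rfl
      · rw [not_not.1 h0, norm_zero, Real.zero_rpow hq.ne']
    rw [hsum]
    have hGT : ∀ i : G, T (b i) ≠ 0 := fun i => (Finset.mem_filter.1 i.2).2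
    have h1 := h G (fun i => b i) (fun i => gvec T b i)
      (b.orthonormal.comp _ Subtype.val_injective)
      ⟨fun i => gvec_norm (hGT i), fun i j hij =>
        gvec_orth hb1 i j (fun h => hij (Subtype.ext h))⟩
    rw [PiLp.norm_eq_sum hq] at h1
    have h2 : ∀ i : G, ‖(entries p T (fun i : G => b i) (fun i : G => gvec T b i)) i‖ =
        ‖T (b i)‖ := by
      intro i
      change ‖inner ℂ (gvec T b i) (T (b i))‖ = _
      conv_lhs => rw [gvec_smul T b i]
      rw [inner_smul_right, inner_self_eq_norm_sq_to_K, gvec_norm (hGT i)]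
      simp
    simp_rw [h2] at h1
    have h3 := Real.rpow_le_rpow (by positivity) h1 hq.le
    rw [← Real.rpow_mul (Finset.sum_nonneg fun k _ => by positivity),
      one_div_mul_cancel hq.ne', Real.rpow_one] at h3
    rwa [← Finset.sum_coe_sort G (fun i => ‖T (b i)‖ ^ p.toReal)]
  have := ENNReal.rpow_le_rpow htr (one_div_nonneg.2 hq.le)
  rwa [ENNReal.ofReal_rpow_of_nonneg (by positivity) (by positivity), ← Real.rpow_mul hM,
    mul_one_div_cancel hq.ne', Real.rpow_one] at this

end Helpers

/-- (Lemma 2.7.)  Let `H` be a separable Hilbert space, `n ∈ ℕ`, `p ∈ [1,∞]`, and let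
`A`, `B` be bounded self-adjoint operators on `H`.  Then
`‖ad_B^n (A)‖_p ≤ 2^{n+1} ‖A Bⁿ‖_p`, where `‖·‖_p` is the Schatten `p`-norm
(value `+∞` allowed; operator norm for `p = ∞`). -/
theorem schatten_norm_iterated_commutator_le [CompleteSpace E]
    [TopologicalSpace.SeparableSpace E]
    (n : ℕ) (p : ℝ≥0∞) (hp : 1 ≤ p) (A B : E →L[ℂ] E)
    (hA : IsSelfAdjoint A) (hB : IsSelfAdjoint B) :
    schattenE p (adIter B n A) ≤ 2 ^ (n + 1) * schattenE p (A * B ^ n) := by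
  haveI : Fact (1 ≤ p) := ⟨hp⟩
  by_cases htop : schattenE p (A * B ^ n) = ⊤
  · rw [htop, ENNReal.mul_top (by positivity)]
    exact le_top
  have hM : 0 ≤ (schattenE p (A * B ^ n)).toReal := ENNReal.toReal_nonneg
  have h1 : SB p (A * B ^ n) (schattenE p (A * B ^ n)).toReal :=
    SB_of_schatten hM (by rw [ENNReal.ofReal_toReal htop])
  have h2 := SB_adIter hA hB hM n 0 0 (by simpa using h1)
  rw [pow_zero, one_mul, mul_one] at h2
  refine (schatten_of_SB (by positivity) h2).trans ?_
  rw [ENNReal.ofReal_mul (by positivity), ENNReal.ofReal_toReal htop]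
  gcongr
  rw [ENNReal.ofReal_pow (by norm_num), ENNReal.ofReal_ofNat]
  exact pow_le_pow_right₀ (by norm_num) (Nat.le_succ n)

end
end
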